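/- For every α ∈ (0,1), the map ℛ_α : 𝒱₁ → 𝒱₁ has a fixed point: there exists f* ∈ 𝒱₁ such that ℛ_α(f*)(x) = f*(x) for all x ∈ ℝ. -/

import Mathlib

open Real MeasureTheory Set Filter BoundedContinuousFunction

noncomputable section

namespace GSQGplane

/-- The constant `c_{1,α} = 2^{2α-1} Γ(1/2+α) / (√π Γ(1-α))`. -/
def C1 (α : ℝ) : ℝ :=
  (2:ℝ) ^ (2*α - 1) * Real.Gamma (1/2 + α) / (Real.sqrt π * Real.Gamma (1 - α))

/-- The constant `η = 2 (3/(2(3-2α)(5-2α)(1+4^α)))^{1/min(α,1-α)}`. -/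
def etaC (α : ℝ) : ℝ :=
  2 * (3 / (2*(3 - 2*α)*(5 - 2*α)*(1 + (4:ℝ) ^ α))) ^ (1 / min α (1 - α))

/-- The weight `ρ(x) = (1+|x|)^{-α}`. -/
def rho (α : ℝ) (x : ℝ) : ℝ := (1 + |x|) ^ (-α)

/-- The invariant set `𝒱₁`: even continuous functions with finite weighted sup-norm,
`f(0)=1`, nonnegative and non-increasing on `[0,∞)`, `x ↦ f(√x)` convex,
`f ≥ max(0,1-x²)`, and left derivative at `1/2` at most `-η`. -/
def V1 (α : ℝ) (f : ℝ → ℝ) : Prop :=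
  Continuous f ∧ (∀ x : ℝ, f (-x) = f x) ∧ (∃ M : ℝ, ∀ x : ℝ, rho α x * |f x| ≤ M) ∧
  f 0 = 1 ∧ (∀ x ∈ Ici (0:ℝ), 0 ≤ f x) ∧ AntitoneOn f (Ici (0:ℝ)) ∧
  ConvexOn ℝ (Ici (0:ℝ)) (fun x => f (Real.sqrt x)) ∧
  (∀ x : ℝ, max 0 (1 - x^2) ≤ f x) ∧
  (∃ d : ℝ, HasDerivWithinAt f d (Iio (1/2 : ℝ)) (1/2 : ℝ) ∧ d ≤ -(etaC α))

/-- The normalization functional `c(f)`. -/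
def cV (α : ℝ) (f : ℝ → ℝ) : ℝ :=
  (2*α*(1+2*α)/3) * C1 α * ∫ ξ in Ioi (0:ℝ), (1 - f ξ) * ξ ^ (-1 - 2*α)

/-- The functional `b(f) = 2 c_{1,α} ∫₀^∞ f(ξ) ξ^{1-2α} dξ`. -/
def bV (α : ℝ) (f : ℝ → ℝ) : ℝ :=
  2 * C1 α * ∫ ξ in Ioi (0:ℝ), f ξ * ξ ^ (1 - 2*α)

/-- The linear operator `𝒯_α(f)`, defined for `x > 0`, set to `0` at `x = 0`,
and extended evenly to `ℝ` (via `|x|`). -/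
def TV (α : ℝ) (f : ℝ → ℝ) (x : ℝ) : ℝ :=
  if x = 0 then 0
  else if α = 1/2 then
    C1 α * ∫ ξ in Ioi (0:ℝ), f ξ * ((ξ / |x|) * Real.log ((|x| + ξ) / |(|x| - ξ)|) - 2)
  else
    (C1 α / (1 - 2*α)) * ∫ ξ in Ioi (0:ℝ),
      f ξ * ((ξ / |x|) * ((|x| + ξ) ^ (1 - 2*α) - |(|x| - ξ)| ^ (1 - 2*α))
        - 2*(1 - 2*α) * ξ ^ (1 - 2*α))

/-- The nonlinear map `ℛ_α(f)(x) = max(0, 1 + 𝒯_α(f)(x)/c(f))`. -/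
def RV (α : ℝ) (f : ℝ → ℝ) (x : ℝ) : ℝ := max 0 (1 + TV α f x / cV α f)

/-- An even primitive of `r ↦ r^{-2α}`. -/
def prim0 (α z : ℝ) : ℝ :=
  if α = 1/2 then Real.log |z| else |z| ^ (1 - 2*α) / (1 - 2*α)

/-- An even primitive of `r ↦ r^{2-2α}`. -/
def prim2 (α z : ℝ) : ℝ := |z| ^ (3 - 2*α) / (3 - 2*α)

/-- An even primitive of `r ↦ r^{4-2α}`. -/
def prim4 (α z : ℝ) : ℝ := |z| ^ (5 - 2*α) / (5 - 2*α)

/-- The odd extension of `r ↦ r^{-2α}`. -/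
def oddPow (α z : ℝ) : ℝ := z * |z| ^ (-1 - 2*α)

lemma hasDerivAt_abs_rpow {z : ℝ} (hz : z ≠ 0) (s : ℝ) :
    HasDerivAt (fun z => |z| ^ s) (s * (z * |z| ^ (s - 2))) z := by
  have hp : 0 < |z| := abs_pos.2 hz
  refine ((hasDerivAt_abs hz).rpow_const (p := s) (Or.inl hp.ne')).congr_deriv ?_
  have h2 : |z| ^ (s - 1) = |z| ^ (s - 2) * |z| := by
    rw [← Real.rpow_add_one hp.ne']; ring_nf
  have h3 : (SignType.sign z : ℝ) * |z| = z := sign_mul_abs z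
  rw [h2]
  linear_combination (s * |z| ^ (s - 2)) * h3

lemma abs_rpow_add_two {z : ℝ} (hz : z ≠ 0) (s : ℝ) : |z| ^ (s + 2) = z ^ 2 * |z| ^ s := by
  have hp : 0 < |z| := abs_pos.2 hz
  rw [Real.rpow_add hp, Real.rpow_two, sq_abs, mul_comm]

lemma hasDerivAt_prim0 (α : ℝ) {z : ℝ} (hz : z ≠ 0) :
    HasDerivAt (prim0 α) (oddPow α z) z := by
  by_cases h : α = 1/2
  · have h1 : prim0 α = fun z => Real.log z := by
      funext z; simp [prim0, h]
    rw [h1]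
    refine (Real.hasDerivAt_log hz).congr_deriv ?_
    have : oddPow α z = z * |z| ^ (-2 : ℝ) := by
      rw [oddPow, h]; norm_num
    rw [this, Real.rpow_neg (abs_nonneg z), Real.rpow_two, sq_abs]
    field_simp
  · have h1 : prim0 α = fun z => |z| ^ (1 - 2*α) / (1 - 2*α) := by
      funext z; simp only [prim0, if_neg h]
    have h2 : 1 - 2*α ≠ 0 := fun h' => h (by linarith)
    rw [h1]
    refine ((hasDerivAt_abs_rpow hz (1 - 2*α)).div_const (1 - 2*α)).congr_deriv ?_
    rw [oddPow, show 1 - 2*α - 2 = -1 - 2*α by ring]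
    field_simp

lemma hasDerivAt_prim2 {α : ℝ} (hα : α < 1) {z : ℝ} (hz : z ≠ 0) :
    HasDerivAt (prim2 α) (z ^ 2 * oddPow α z) z := by
  have h2 : 3 - 2*α ≠ 0 := by linarith
  refine ((hasDerivAt_abs_rpow hz (3 - 2*α)).div_const (3 - 2*α)).congr_deriv ?_
  rw [oddPow, show 3 - 2*α - 2 = -1 - 2*α + 2 by ring, abs_rpow_add_two hz]
  field_simp

lemma hasDerivAt_prim4 {α : ℝ} (hα : α < 1) {z : ℝ} (hz : z ≠ 0) :
    HasDerivAt (prim4 α) (z ^ 4 * oddPow α z) z := by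
  have h2 : 5 - 2*α ≠ 0 := by linarith
  refine ((hasDerivAt_abs_rpow hz (5 - 2*α)).div_const (5 - 2*α)).congr_deriv ?_
  rw [oddPow, show 5 - 2*α - 2 = -1 - 2*α + 2 + 2 by ring, abs_rpow_add_two hz,
    abs_rpow_add_two hz]
  field_simp

lemma prim2_eq {α : ℝ} (hα : α < 1) {z : ℝ} (hz : z ≠ 0) :
    (3 - 2*α) * prim2 α z = z ^ 3 * oddPow α z := by
  have h2 : 3 - 2*α ≠ 0 := by linarith
  rw [prim2, oddPow, show 3 - 2*α = -1 - 2*α + 2 + 2 by ring, abs_rpow_add_two hz,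
    abs_rpow_add_two hz]
  have h3 : -1 - 2*α + 2 + 2 ≠ 0 := by linarith
  field_simp

lemma prim4_eq {α : ℝ} (hα : α < 1) {z : ℝ} (hz : z ≠ 0) :
    (5 - 2*α) * prim4 α z = z ^ 5 * oddPow α z := by
  rw [prim4, oddPow, show 5 - 2*α = -1 - 2*α + 2 + 2 + 2 by ring, abs_rpow_add_two hz,
    abs_rpow_add_two hz, abs_rpow_add_two hz]
  have h3 : -1 - 2*α + 2 + 2 + 2 ≠ 0 := by linarith
  field_simp

lemma prim0_sub_eq (α : ℝ) {z w : ℝ} (hz : z ≠ 0) (hw : w ≠ 0) :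
    (1 - 2*α) * (prim0 α z - prim0 α w) = z * oddPow α z - w * oddPow α w := by
  have key : ∀ z : ℝ, z ≠ 0 → z * oddPow α z = |z| ^ (1 - 2*α) := by
    intro z hz
    rw [oddPow, show 1 - 2*α = -1 - 2*α + 2 by ring, abs_rpow_add_two hz]; ring
  rw [key z hz, key w hw]
  by_cases h : α = 1/2
  · simp [h]
  · have h2 : 1 - 2*α ≠ 0 := fun h' => h (by linarith)
    simp only [prim0, if_neg h]
    field_simp

lemma oddPow_of_pos (α : ℝ) {r : ℝ} (hr : 0 < r) : oddPow α r = r * r ^ (-1 - 2*α) := by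
  rw [oddPow, abs_of_pos hr]

lemma prim0_abs (α z : ℝ) : prim0 α |z| = prim0 α z := by simp [prim0]
lemma prim2_abs (α z : ℝ) : prim2 α |z| = prim2 α z := by simp [prim2]

lemma prim4_abs (α z : ℝ) : prim4 α |z| = prim4 α z := by simp [prim4]

/-- `∫_{|x-y|}^{x+y} r^{-2α} dr`. -/
def J0 (α x y : ℝ) : ℝ := prim0 α (x + y) - prim0 α (x - y)
/-- `∫_{|x-y|}^{x+y} r^{2-2α} dr`. -/
def J2 (α x y : ℝ) : ℝ := prim2 α (x + y) - prim2 α (x - y)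
/-- `∫_{|x-y|}^{x+y} r^{4-2α} dr`. -/
def J4 (α x y : ℝ) : ℝ := prim4 α (x + y) - prim4 α (x - y)

lemma J0_comm (α x y : ℝ) : J0 α x y = J0 α y x := by
  rw [J0, J0, add_comm, ← prim0_abs α (x - y), abs_sub_comm, prim0_abs]
lemma J2_comm (α x y : ℝ) : J2 α x y = J2 α y x := by
  rw [J2, J2, add_comm, ← prim2_abs α (x - y), abs_sub_comm, prim2_abs]

/-- `∫_{|x-y|}^{x+y} (x² + y² - r²) r^{-2α} dr`. -/
def kap (α x y : ℝ) : ℝ := (x^2 + y^2) * J0 α x y - J2 α x y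

/-- The kernel of the linearised operator. -/
def ker (α x y : ℝ) : ℝ := if x = y then 0 else y / (2 * x^3) * kap α x y

lemma kap_comm (α x y : ℝ) : kap α x y = kap α y x := by
  rw [kap, kap, J0_comm, J2_comm]; ring

lemma hasDerivAt_rpow_pos {r : ℝ} (hr : 0 < r) (α : ℝ) :
    HasDerivAt (fun r : ℝ => r ^ (-1 - 2*α)) (-(1 + 2*α) * (r * r ^ (-3 - 2*α))) r := by
  convert Real.hasDerivAt_rpow_const (x := r) (p := -1 - 2*α) (Or.inl hr.ne') using 1
  rw [show -1 - 2*α - 1 = -3 - 2*α + 1 by ring, Real.rpow_add_one hr.ne']; ring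

lemma rpow_split {r : ℝ} (hr : 0 < r) (α : ℝ) : r ^ (-1 - 2*α) = r^2 * r ^ (-3 - 2*α) := by
  rw [← Real.rpow_two, ← Real.rpow_add hr]; ring_nf

lemma le_of_hasDerivAt_nonneg {F F' : ℝ → ℝ} {a b : ℝ} (hab : a ≤ b)
    (hF : ∀ r ∈ Icc a b, HasDerivAt F (F' r) r) (hF' : ∀ r ∈ Icc a b, 0 ≤ F' r) : F a ≤ F b := by
  refine (monotoneOn_of_deriv_nonneg (convex_Icc a b) ?_ ?_ ?_) (left_mem_Icc.2 hab)
    (right_mem_Icc.2 hab) hab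
  · exact fun r hr => (hF r hr).continuousAt.continuousWithinAt
  · exact fun r hr => (hF r (interior_subset hr)).differentiableAt.differentiableWithinAt
  · intro r hr
    rw [(hF r (interior_subset hr)).deriv]
    exact hF' r (interior_subset hr)

lemma abs_sub_bounds {x y : ℝ} (hx : 0 < x) (hy : 0 < y) (hxy : x ≠ y) :
    0 < |x - y| ∧ |x - y| ≤ x + y ∧ |x - y|^2 = (x - y)^2 := by
  refine ⟨abs_pos.2 (sub_ne_zero.2 hxy), ?_, sq_abs _⟩
  rw [abs_le]; constructor <;> linarith

lemma kap_bounds {α : ℝ} (h0 : 0 < α) (h1 : α < 1) {x y : ℝ} (hx : 0 < x) (hy : 0 < y)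
    (hxy : x ≠ y) :
    0 ≤ kap α x y ∧
      kap α x y ≤ (1 + 2*α) / 4 * |x - y| ^ (-3 - 2*α) * (16 / 3 * x^3 * y^3) := by
  obtain ⟨hd0, hds, hd2⟩ := abs_sub_bounds hx hy hxy
  set d := |x - y| with hd
  set W : ℝ → ℝ := fun r => (r^2 - d^2) * ((x+y)^2 - r^2) with hW
  have hWnn : ∀ r ∈ Icc d (x + y), 0 ≤ W r := by
    intro r hr
    apply mul_nonneg
    · nlinarith [hr.1]
    · nlinarith [hr.2, hr.1]
  set F : ℝ → ℝ := fun r => (x^2 + y^2) * prim0 α r - prim2 α r - W r * r ^ (-1 - 2*α) / 4 with hF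
  have hW' : ∀ r, HasDerivAt W (2*r*(2*(x^2+y^2) - 2*r^2)) r := by
    intro r
    have e1 : HasDerivAt (fun r : ℝ => r^2) (2*r) r := by simpa using hasDerivAt_pow 2 r
    refine ((e1.sub_const (d^2)).mul (e1.const_sub ((x+y)^2))).congr_deriv ?_
    rw [hd2]; ring
  have hcont : ∀ r ∈ Icc d (x+y), 0 < r := fun r hr => lt_of_lt_of_le hd0 hr.1
  have hF' : ∀ r ∈ Icc d (x+y), HasDerivAt F ((1+2*α)/4 * (W r * (r * r^(-3-2*α)))) r := by
    intro r hr
    replace hr := hcont r hr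
    refine ((((hasDerivAt_prim0 α hr.ne').const_mul (x^2+y^2)).sub
      (hasDerivAt_prim2 h1 hr.ne')).sub
      (((hW' r).mul (hasDerivAt_rpow_pos hr α)).div_const 4)).congr_deriv ?_
    rw [oddPow_of_pos α hr, rpow_split hr]
    ring
  have hends : F (x + y) - F d = kap α x y := by
    have w1 : W (x + y) = 0 := by simp [hW]
    have w2 : W d = 0 := by simp [hW]
    simp only [hF, w1, w2, kap, J0, J2]
    rw [hd, prim0_abs, prim2_abs]
    ring
  constructor
  · rw [← hends, sub_nonneg]
    refine le_of_hasDerivAt_nonneg hds hF' fun r hr => ?_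
    have := hWnn r hr
    have := hcont r hr
    positivity
  · set V : ℝ → ℝ := fun r => -r^6/6 + (x^2+y^2)*r^4/2 - d^2*(x+y)^2*r^2/2 with hV
    have hV' : ∀ r, HasDerivAt V (W r * r) r := by
      intro r
      have e2 : HasDerivAt (fun r : ℝ => r^2) (2*r) r := by simpa using hasDerivAt_pow 2 r
      have e4 : HasDerivAt (fun r : ℝ => r^4) (4*r^3) r := by simpa using hasDerivAt_pow 4 r
      have e6 : HasDerivAt (fun r : ℝ => r^6) (6*r^5) r := by simpa using hasDerivAt_pow 6 r
      refine ((((e6.neg).div_const 6).add ((e4.const_mul (x^2+y^2)).div_const 2)).sub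
        ((e2.const_mul (d^2*(x+y)^2)).div_const 2)).congr_deriv ?_
      simp only [hW, hd2]
      ring
    set c := (1+2*α)/4 * d^(-3-2*α) with hc
    have hVends : V (x+y) - V d = 16/3*x^3*y^3 := by
      have e4 : d^4 = (x-y)^4 := by rw [show d^4 = (d^2)^2 by ring, hd2]; ring
      have e6 : d^6 = (x-y)^6 := by rw [show d^6 = (d^2)^3 by ring, hd2]; ring
      simp only [hV, e4, e6, hd2]; ring
    rw [← hends, ← hVends]
    have : c * V d - F d ≤ c * V (x+y) - F (x+y) := by
      refine le_of_hasDerivAt_nonneg (F := fun r => c * V r - F r) hds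
        (fun r hr => ((hV' r).const_mul c).sub (hF' r hr)) fun r hr => ?_
      have a1 := hWnn r hr
      have a2 := hcont r hr
      have a3 : r^(-3-2*α) ≤ d^(-3-2*α) :=
        Real.rpow_le_rpow_of_nonpos hd0 hr.1 (by linarith)
      have : c * (W r * r) - (1+2*α)/4 * (W r * (r * r^(-3-2*α)))
        = (1+2*α)/4 * (W r * r) * (d^(-3-2*α) - r^(-3-2*α)) := by rw [hc]; ring
      rw [this]
      have := sub_nonneg.2 a3
      positivity
    linarith [mul_sub c (V (x+y)) (V d)]

/-- `∫_{|x-y|}^{x+y} (3(x²+y²-r²)² - 4x²y²) r^{-2α} dr`. -/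
def secondMoment (α x y : ℝ) : ℝ :=
  3 * ((x^2+y^2)^2 * J0 α x y - 2*(x^2+y^2) * J2 α x y + J4 α x y) - 4*x^2*y^2 * J0 α x y

lemma secondMoment_nonneg {α : ℝ} (h0 : 0 < α) (h1 : α < 1) {x y : ℝ} (hx : 0 < x) (hy : 0 < y)
    (hxy : x ≠ y) : 0 ≤ secondMoment α x y := by
  obtain ⟨hd0, hds, hd2⟩ := abs_sub_bounds hx hy hxy
  set d := |x - y| with hd
  obtain ⟨c, hc⟩ : ∃ c, c = x^2 + y^2 := ⟨_, rfl⟩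
  have hc0 : 0 < c := by rw [hc]; positivity
  set W : ℝ → ℝ := fun r => 4*x^2*y^2 - (c - r^2)^2 with hW
  have hWnn : ∀ r ∈ Icc d (x + y), 0 ≤ W r := by
    intro r hr
    have : W r = (r^2 - d^2) * ((x+y)^2 - r^2) := by
      simp only [hW, hd2, hc]; ring
    rw [this]
    apply mul_nonneg
    · nlinarith [hr.1]
    · nlinarith [hr.2, hr.1]
  obtain ⟨b, hb⟩ : ∃ b, b = (√c) ^ (-3 - 2*α) := ⟨_, rfl⟩
  set F : ℝ → ℝ := fun r => 3*(c^2 * prim0 α r - 2*c*prim2 α r + prim4 α r) - 4*x^2*y^2*prim0 α r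
    - (c - r^2) * W r * r ^ (-1 - 2*α) / 2
    + (1+2*α)/2 * b * (4*x^2*y^2*(c-r^2)^2/4 - (c-r^2)^4/8) with hF
  have hcont : ∀ r ∈ Icc d (x+y), 0 < r := fun r hr => lt_of_lt_of_le hd0 hr.1
  have hF' : ∀ r ∈ Icc d (x+y), HasDerivAt F
      ((1+2*α)/2 * (W r * r * ((c - r^2) * (r^(-3-2*α) - b)))) r := by
    intro r hr
    replace hr := hcont r hr
    have e2 : HasDerivAt (fun r : ℝ => r^2) (2*r) r := by simpa using hasDerivAt_pow 2 r
    have ec := e2.const_sub c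
    have ec2 := ec.pow 2
    have ec4 := ec.pow 4
    have p0 := hasDerivAt_prim0 α hr.ne'
    refine (((((((p0.const_mul (c^2)).sub ((hasDerivAt_prim2 h1 hr.ne').const_mul (2*c))).add
      (hasDerivAt_prim4 h1 hr.ne')).const_mul 3).sub (p0.const_mul (4*x^2*y^2))).sub
      (((ec.mul (ec2.const_sub (4*x^2*y^2))).mul (hasDerivAt_rpow_pos hr α)).div_const 2)).add
      ((((ec2.const_mul (4*x^2*y^2)).div_const 4).sub (ec4.div_const 8)).const_mul
        ((1+2*α)/2*b))).congr_deriv ?_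
    rw [oddPow_of_pos α hr, rpow_split hr]
    simp only [hW, Pi.pow_apply]
    push_cast
    simp only [Pi.mul_apply]
    ring
  have hends : F (x + y) - F d = secondMoment α x y := by
    have w1 : W (x + y) = 0 := by simp only [hW, hc]; ring
    have w2 : W d = 0 := by simp only [hW, hc, hd2]; ring
    simp only [hF, w1, w2, secondMoment, J0, J2, J4, hd2]
    rw [hd, prim0_abs, prim2_abs, prim4_abs, hc]
    ring
  rw [← hends, sub_nonneg]
  refine le_of_hasDerivAt_nonneg hds hF' fun r hr => ?_
  have a1 := hWnn r hr
  have a2 := hcont r hr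
  have : 0 ≤ (c - r^2) * (r^(-3-2*α) - b) := by
    have hs : √c ^ 2 = c := Real.sq_sqrt hc0.le
    have hs0 : 0 < √c := Real.sqrt_pos.2 hc0
    rcases le_total r (√c) with h | h
    · apply mul_nonneg
      · nlinarith
      · rw [hb, sub_nonneg]
        exact Real.rpow_le_rpow_of_nonpos a2 h (by linarith)
    · apply mul_nonneg_of_nonpos_of_nonpos
      · nlinarith
      · rw [hb, sub_nonpos]
        exact Real.rpow_le_rpow_of_nonpos hs0 h (by linarith)
  positivity

section JDeriv
variable {α x y : ℝ}

lemma hasDerivAt_J0_left (hp : x + y ≠ 0) (hm : x - y ≠ 0) :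
    HasDerivAt (fun x => J0 α x y) (oddPow α (x + y) - oddPow α (x - y)) x :=
  (((hasDerivAt_prim0 α hp).comp_add_const x y).sub
    ((hasDerivAt_prim0 α hm).comp_sub_const x y))

lemma hasDerivAt_J0_right (hp : x + y ≠ 0) (hm : x - y ≠ 0) :
    HasDerivAt (fun y => J0 α x y) (oddPow α (x + y) + oddPow α (x - y)) y :=
  (((hasDerivAt_prim0 α hp).comp_const_add x y).sub
    ((hasDerivAt_prim0 α hm).comp_const_sub x y)).congr_deriv (by ring)

lemma hasDerivAt_J2_left (h1 : α < 1) (hp : x + y ≠ 0) (hm : x - y ≠ 0) :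
    HasDerivAt (fun x => J2 α x y)
      ((x + y)^2 * oddPow α (x + y) - (x - y)^2 * oddPow α (x - y)) x :=
  (((hasDerivAt_prim2 h1 hp).comp_add_const x y).sub
    ((hasDerivAt_prim2 h1 hm).comp_sub_const x y))

lemma hasDerivAt_J2_right (h1 : α < 1) (hp : x + y ≠ 0) (hm : x - y ≠ 0) :
    HasDerivAt (fun y => J2 α x y)
      ((x + y)^2 * oddPow α (x + y) + (x - y)^2 * oddPow α (x - y)) y :=
  (((hasDerivAt_prim2 h1 hp).comp_const_add x y).sub
    ((hasDerivAt_prim2 h1 hm).comp_const_sub x y)).congr_deriv (by ring)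

lemma hasDerivAt_J4_left (h1 : α < 1) (hp : x + y ≠ 0) (hm : x - y ≠ 0) :
    HasDerivAt (fun x => J4 α x y)
      ((x + y)^4 * oddPow α (x + y) - (x - y)^4 * oddPow α (x - y)) x :=
  (((hasDerivAt_prim4 h1 hp).comp_add_const x y).sub
    ((hasDerivAt_prim4 h1 hm).comp_sub_const x y))

lemma hasDerivAt_J4_right (h1 : α < 1) (hp : x + y ≠ 0) (hm : x - y ≠ 0) :
    HasDerivAt (fun y => J4 α x y)
      ((x + y)^4 * oddPow α (x + y) + (x - y)^4 * oddPow α (x - y)) y :=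
  (((hasDerivAt_prim4 h1 hp).comp_const_add x y).sub
    ((hasDerivAt_prim4 h1 hm).comp_const_sub x y)).congr_deriv (by ring)

lemma J0_eq (hp : x + y ≠ 0) (hm : x - y ≠ 0) :
    (1 - 2*α) * J0 α x y = (x + y) * oddPow α (x + y) - (x - y) * oddPow α (x - y) :=
  prim0_sub_eq α hp hm

lemma J2_eq (h1 : α < 1) (hp : x + y ≠ 0) (hm : x - y ≠ 0) :
    (3 - 2*α) * J2 α x y = (x + y)^3 * oddPow α (x + y) - (x - y)^3 * oddPow α (x - y) := by
  rw [J2, mul_sub, prim2_eq h1 hp, prim2_eq h1 hm]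

lemma J4_eq (h1 : α < 1) (hp : x + y ≠ 0) (hm : x - y ≠ 0) :
    (5 - 2*α) * J4 α x y = (x + y)^5 * oddPow α (x + y) - (x - y)^5 * oddPow α (x - y) := by
  rw [J4, mul_sub, prim4_eq h1 hp, prim4_eq h1 hm]

end JDeriv

/-- `∫₀^R K(x,y) dy` in closed form. -/
def kerInt (α x R : ℝ) : ℝ :=
  ((R^2 + 3*x^2) * ((R^2 - x^2) * J0 α x R) + 2*(R^2 + 3*x^2) * J2 α x R - 3 * J4 α x R) /
    (16 * (1 - α) * x^3)

/-- `x⁻¹ ∫₀^R y J0(x,y) dy` in closed form. -/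
def potInt (α x R : ℝ) : ℝ := ((R^2 - x^2) * J0 α x R + J2 α x R) / (4 * (1 - α) * x)

section closed
variable {α x y : ℝ}

lemma hasDerivAt_kerInt_right (h1 : α < 1) (hx : 0 < x) (hy : 0 < y) (hxy : x ≠ y) :
    HasDerivAt (fun y => kerInt α x y) (ker α x y) y := by
  have hp : x + y ≠ 0 := by positivity
  have hm : x - y ≠ 0 := sub_ne_zero.2 hxy
  have e2 : HasDerivAt (fun r : ℝ => r^2) (2*y) y := by simpa using hasDerivAt_pow 2 y
  have h1' : 1 - α ≠ 0 := by linarith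
  refine (((((e2.add_const (3*x^2)).mul
    ((e2.sub_const (x^2)).mul (hasDerivAt_J0_right hp hm))).add
    (((e2.add_const (3*x^2)).const_mul 2).mul (hasDerivAt_J2_right h1 hp hm))).sub
    ((hasDerivAt_J4_right h1 hp hm).const_mul 3)).div_const (16 * (1 - α) * x^3)).congr_deriv ?_
  rw [ker, if_neg hxy, kap]
  simp only [Pi.mul_apply]
  have r0 := J0_eq (α := α) hp hm
  have r2 := J2_eq h1 hp hm
  field_simp
  linear_combination (-8*y*(x^2+y^2)) * r0 + 8*y*r2

lemma hasDerivAt_kerInt_left (h1 : α < 1) (hx : 0 < x) (hy : 0 < y) (hxy : x ≠ y) :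
    HasDerivAt (fun x => kerInt α x y) (-(1/(8*x^4)) * secondMoment α x y) x := by
  have hp : x + y ≠ 0 := by positivity
  have hm : x - y ≠ 0 := sub_ne_zero.2 hxy
  have e2 : HasDerivAt (fun r : ℝ => r^2) (2*x) x := by simpa using hasDerivAt_pow 2 x
  have e3 : HasDerivAt (fun r : ℝ => r^3) (3*x^2) x := by simpa using hasDerivAt_pow 3 x
  have h1' : 1 - α ≠ 0 := by linarith
  have eA := (e2.const_mul 3).const_add (y^2)
  refine ((((eA.mul ((e2.const_sub (y^2)).mul (hasDerivAt_J0_left hp hm))).add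
    ((eA.const_mul 2).mul (hasDerivAt_J2_left h1 hp hm))).sub
    ((hasDerivAt_J4_left h1 hp hm).const_mul 3)).div (e3.const_mul (16 * (1 - α)))
    (by positivity)).congr_deriv ?_
  rw [secondMoment]
  simp only [Pi.mul_apply, Pi.add_apply, Pi.sub_apply]
  have r0 := J0_eq (α := α) hp hm
  have r2 := J2_eq h1 hp hm
  have r4 := J4_eq h1 hp hm
  field_simp
  linear_combination (16*x^2*y^2+24*x^4+24*y^4) * r0 - 48*(x^2+y^2) * r2 + 24*r4

lemma hasDerivAt_potInt_right (h1 : α < 1) (hx : 0 < x) (hy : 0 < y) (hxy : x ≠ y) :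
    HasDerivAt (fun y => potInt α x y) (J0 α x y * y / x) y := by
  have hp : x + y ≠ 0 := by positivity
  have hm : x - y ≠ 0 := sub_ne_zero.2 hxy
  have e2 : HasDerivAt (fun r : ℝ => r^2) (2*y) y := by simpa using hasDerivAt_pow 2 y
  have h1' : 1 - α ≠ 0 := by linarith
  refine ((((e2.sub_const (x^2)).mul (hasDerivAt_J0_right hp hm)).add
    (hasDerivAt_J2_right h1 hp hm)).div_const (4 * (1 - α) * x)).congr_deriv ?_
  have r0 := J0_eq (α := α) hp hm
  field_simp
  linear_combination (-2*y) * r0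

lemma hasDerivAt_potInt_left (h1 : α < 1) (hx : 0 < x) (hy : 0 < y) (hxy : x ≠ y) :
    HasDerivAt (fun x => potInt α x y) (-(x / y) * ker α x y) x := by
  have hp : x + y ≠ 0 := by positivity
  have hm : x - y ≠ 0 := sub_ne_zero.2 hxy
  have e2 : HasDerivAt (fun r : ℝ => r^2) (2*x) x := by simpa using hasDerivAt_pow 2 x
  have h1' : 1 - α ≠ 0 := by linarith
  refine ((((e2.const_sub (y^2)).mul (hasDerivAt_J0_left hp hm)).add
    (hasDerivAt_J2_left h1 hp hm)).div ((hasDerivAt_id x).const_mul (4 * (1 - α)))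
      (by simp; exact ⟨h1', hx.ne'⟩)).congr_deriv ?_
  simp only [Pi.mul_apply, Pi.add_apply, id]
  have r0 := J0_eq (α := α) hp hm
  have r2 := J2_eq h1 hp hm
  rw [ker, if_neg hxy, kap]
  field_simp
  linear_combination (2*(x^2+y^2)) * r0 - 2 * r2

end closed

section continuity
variable {α : ℝ}

lemma continuous_prim2 (h1 : α < 1) : Continuous (prim2 α) :=
  (continuous_abs.rpow_const fun _ => Or.inr (by linarith)).div_const _

lemma continuous_prim4 (h1 : α < 1) : Continuous (prim4 α) :=
  (continuous_abs.rpow_const fun _ => Or.inr (by linarith)).div_const _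

lemma continuous_mul_prim0 (h1 : α < 1) : Continuous fun z => z * prim0 α z := by
  by_cases h : α = 1/2
  · have : (fun z => z * prim0 α z) = fun z => z * Real.log z := by
      funext z; simp [prim0, h]
    rw [this]; exact Real.continuous_mul_log
  · rw [continuous_iff_continuousAt]
    intro z
    by_cases hz : z = 0
    · subst hz
      rw [ContinuousAt, zero_mul]
      have hc : Continuous fun z : ℝ => |z| ^ (2 - 2*α) / |1 - 2*α| :=
        (continuous_abs.rpow_const fun _ => Or.inr (by linarith)).div_const _
      have ht := hc.tendsto 0
      simp only [abs_zero] at ht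
      rw [Real.zero_rpow (by linarith), zero_div] at ht
      refine squeeze_zero_norm (fun z => ?_) ht
      simp only [prim0, if_neg h, norm_mul, norm_div, Real.norm_eq_abs]
      rw [abs_of_nonneg (Real.rpow_nonneg (abs_nonneg z) _)]
      rcases eq_or_ne z 0 with rfl | hz
      · simp; positivity
      · rw [show 2 - 2*α = 1 - 2*α + 1 by ring, Real.rpow_add_one (abs_pos.2 hz).ne']
        apply le_of_eq; ring
    · exact continuousAt_id.mul (hasDerivAt_prim0 α hz).continuousAt

lemma continuousAt_sq_sub_mul_J0 (h1 : α < 1) {x y : ℝ} (h : 0 < x + y) :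
    ContinuousAt (fun p : ℝ × ℝ => (p.2^2 - p.1^2) * J0 α p.1 p.2) (x, y) := by
  have e : (fun p : ℝ × ℝ => (p.2^2 - p.1^2) * J0 α p.1 p.2) = fun p : ℝ × ℝ =>
      (p.2^2 - p.1^2) * prim0 α (p.1 + p.2) +
        (p.1 + p.2) * ((p.1 - p.2) * prim0 α (p.1 - p.2)) := by
    funext p; rw [J0]; ring
  rw [e]
  have c1 : ContinuousAt (fun p : ℝ × ℝ => prim0 α (p.1 + p.2)) (x, y) :=
    ContinuousAt.comp (f := fun p : ℝ × ℝ => p.1 + p.2) (g := prim0 α)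
      (hasDerivAt_prim0 α h.ne').continuousAt (by fun_prop)
  have c2 : Continuous (fun p : ℝ × ℝ => (p.1 - p.2) * prim0 α (p.1 - p.2)) :=
    (continuous_mul_prim0 h1).comp (by fun_prop : Continuous fun p : ℝ × ℝ => p.1 - p.2)
  exact ((by fun_prop : ContinuousAt (fun p : ℝ × ℝ => p.2^2 - p.1^2) (x, y)).mul c1).add
    ((by fun_prop : ContinuousAt (fun p : ℝ × ℝ => p.1 + p.2) (x, y)).mul c2.continuousAt)

lemma continuous_J2 (h1 : α < 1) : Continuous (fun p : ℝ × ℝ => J2 α p.1 p.2) :=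
  ((continuous_prim2 h1).comp (by fun_prop : Continuous fun p : ℝ × ℝ => p.1 + p.2)).sub
    ((continuous_prim2 h1).comp (by fun_prop : Continuous fun p : ℝ × ℝ => p.1 - p.2))

lemma continuous_J4 (h1 : α < 1) : Continuous (fun p : ℝ × ℝ => J4 α p.1 p.2) :=
  ((continuous_prim4 h1).comp (by fun_prop : Continuous fun p : ℝ × ℝ => p.1 + p.2)).sub
    ((continuous_prim4 h1).comp (by fun_prop : Continuous fun p : ℝ × ℝ => p.1 - p.2))

lemma continuousAt_kerInt (h1 : α < 1) {x y : ℝ} (hx : 0 < x) (hy : 0 ≤ y) :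
    ContinuousAt (fun p : ℝ × ℝ => kerInt α p.1 p.2) (x, y) := by
  have c0 := continuousAt_sq_sub_mul_J0 h1 (show 0 < x + y by positivity)
  have c2 := (continuous_J2 h1).continuousAt (x := (x, y))
  have c4 := (continuous_J4 h1).continuousAt (x := (x, y))
  have h1' : 1 - α ≠ 0 := by linarith
  refine ContinuousAt.div ((((by fun_prop : ContinuousAt
    (fun p : ℝ × ℝ => p.2^2 + 3*p.1^2) (x, y)).mul c0).add
    ((by fun_prop : ContinuousAt (fun p : ℝ × ℝ => 2*(p.2^2 + 3*p.1^2)) (x, y)).mul c2)).sub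
    (c4.const_mul 3)) (by fun_prop) ?_
  simp only
  positivity

lemma continuousAt_potInt (h1 : α < 1) {x y : ℝ} (hx : 0 < x) (hy : 0 ≤ y) :
    ContinuousAt (fun p : ℝ × ℝ => potInt α p.1 p.2) (x, y) := by
  have c0 := continuousAt_sq_sub_mul_J0 h1 (show 0 < x + y by positivity)
  have c2 := (continuous_J2 h1).continuousAt (x := (x, y))
  have h1' : 1 - α ≠ 0 := by linarith
  refine ContinuousAt.div (c0.add c2) (by fun_prop) ?_
  simp only
  positivity

end continuity

lemma continuousAt_left {F : ℝ → ℝ → ℝ} {x y : ℝ}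
    (h : ContinuousAt (fun p : ℝ × ℝ => F p.1 p.2) (x, y)) : ContinuousAt (fun x => F x y) x :=
  ContinuousAt.comp (f := fun x : ℝ => (x, y)) (g := fun p : ℝ × ℝ => F p.1 p.2) h (by fun_prop)

lemma continuousAt_right {F : ℝ → ℝ → ℝ} {x y : ℝ}
    (h : ContinuousAt (fun p : ℝ × ℝ => F p.1 p.2) (x, y)) : ContinuousAt (F x) y :=
  ContinuousAt.comp (f := fun y : ℝ => (x, y)) (g := fun p : ℝ × ℝ => F p.1 p.2) h (by fun_prop)

/-- Fundamental theorem of calculus for a nonnegative derivative with one exceptional point. -/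
lemma intervalIntegral_of_hasDerivAt_off_point {G g : ℝ → ℝ} {a b c : ℝ} (hab : a ≤ b)
    (hG : ContinuousOn G (Icc a b)) (hd : ∀ x ∈ Ioo a b, x ≠ c → HasDerivAt G (g x) x)
    (hg : ∀ x ∈ Ioo a b, x ≠ c → 0 ≤ g x) :
    IntervalIntegrable g volume a b ∧ ∫ x in a..b, g x = G b - G a := by
  have base : ∀ u v, a ≤ u → u ≤ v → v ≤ b → c ∉ Ioo u v → IntervalIntegrable g volume u v := by
    intro u v hu huv hv hc
    have hsub : ∀ x ∈ Ioo u v, x ∈ Ioo a b ∧ x ≠ c := fun x hx =>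
      ⟨⟨hu.trans_lt hx.1, hx.2.trans_le hv⟩, fun h => hc (h ▸ hx)⟩
    apply intervalIntegral.intervalIntegrable_deriv_of_nonneg (g := G)
    · rw [uIcc_of_le huv]
      exact hG.mono (Icc_subset_Icc hu hv)
    · rw [min_eq_left huv, max_eq_right huv]
      exact fun x hx => hd x (hsub x hx).1 (hsub x hx).2
    · rw [min_eq_left huv, max_eq_right huv]
      exact fun x hx => hg x (hsub x hx).1 (hsub x hx).2
  have hint : IntervalIntegrable g volume a b := by
    by_cases hc : c ∈ Ioo a b
    · exact (base a c le_rfl hc.1.le hc.2.le (by simp)).trans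
        (base c b hc.1.le hc.2.le le_rfl (by simp))
    · exact base a b le_rfl hab le_rfl hc
  exact ⟨hint, integral_eq_of_hasDerivAt_off_countable_of_le G g hab (countable_singleton c) hG
    (fun x hx => hd x hx.1 hx.2) hint⟩

section kernel
variable {α : ℝ}

lemma ker_nonneg (h0 : 0 < α) (h1 : α < 1) {x y : ℝ} (hx : 0 < x) (hy : 0 < y) :
    0 ≤ ker α x y := by
  rw [ker]
  split_ifs with h
  · exact le_rfl
  · exact mul_nonneg (by positivity) (kap_bounds h0 h1 hx hy h).1

lemma ker_le (h0 : 0 < α) (h1 : α < 1) {x y : ℝ} (hx : 0 < x) (hy : 0 < y) (hxy : x ≠ y) :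
    ker α x y ≤ 2/3 * (1 + 2*α) * y^4 * |x - y| ^ (-3 - 2*α) := by
  rw [ker, if_neg hxy]
  refine (mul_le_mul_of_nonneg_left (kap_bounds h0 h1 hx hy hxy).2 (by positivity)).trans
    (le_of_eq ?_)
  field_simp
  ring

lemma pow_mul_ker_comm {x y : ℝ} (hx : 0 < x) (hy : 0 < y) :
    x^4 * ker α x y = y^4 * ker α y x := by
  rw [ker, ker]
  by_cases h : x = y
  · simp [h]
  · rw [if_neg h, if_neg (Ne.symm h), kap_comm α x y]
    field_simp

lemma J0_nonneg {x y : ℝ} (hx : 0 < x) (hy : 0 < y) (hxy : x ≠ y) : 0 ≤ J0 α x y := by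
  obtain ⟨hd0, hds, -⟩ := abs_sub_bounds hx hy hxy
  rw [J0, ← prim0_abs α (x - y), sub_nonneg]
  refine le_of_hasDerivAt_nonneg hds
    (fun r hr => hasDerivAt_prim0 α (hd0.trans_le hr.1).ne') fun r hr => ?_
  have := hd0.trans_le hr.1
  rw [oddPow_of_pos α this]
  positivity

lemma kerInt_zero (x : ℝ) : kerInt α x 0 = 0 := by simp [kerInt, J0, J2, J4]
lemma potInt_zero (x : ℝ) : potInt α x 0 = 0 := by simp [potInt, J0, J2]

lemma integral_ker (h0 : 0 < α) (h1 : α < 1) {x a b : ℝ} (hx : 0 < x) (ha : 0 ≤ a)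
    (hab : a ≤ b) : IntervalIntegrable (ker α x) volume a b ∧
      ∫ y in a..b, ker α x y = kerInt α x b - kerInt α x a := by
  refine intervalIntegral_of_hasDerivAt_off_point (c := x) hab ?_ ?_ ?_
  · exact fun y hy => (continuousAt_right
      (continuousAt_kerInt h1 hx (ha.trans hy.1))).continuousWithinAt
  · exact fun y hy hne => hasDerivAt_kerInt_right h1 hx (ha.trans_lt hy.1) hne.symm
  · exact fun y hy _ => ker_nonneg h0 h1 hx (ha.trans_lt hy.1)

lemma integral_J0 (h1 : α < 1) {x R : ℝ} (hx : 0 < x) (hR : 0 ≤ R) :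
    IntervalIntegrable (fun y => J0 α x y * y / x) volume 0 R ∧
      ∫ y in (0:ℝ)..R, J0 α x y * y / x = potInt α x R := by
  rw [show potInt α x R = potInt α x R - potInt α x 0 by rw [potInt_zero, sub_zero]]
  refine intervalIntegral_of_hasDerivAt_off_point (c := x) hR ?_ ?_ ?_
  · exact fun y hy => (continuousAt_right
      (continuousAt_potInt h1 hx hy.1)).continuousWithinAt
  · exact fun y hy hne => hasDerivAt_potInt_right h1 hx hy.1 hne.symm
  · exact fun y hy hne => div_nonneg (mul_nonneg (J0_nonneg hx hy.1 hne.symm) hy.1.le) hx.le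

lemma kerInt_antitoneOn (h0 : 0 < α) (h1 : α < 1) {R : ℝ} (hR : 0 ≤ R) :
    AntitoneOn (fun x => kerInt α x R) (Ioi 0) := by
  rcases hR.eq_or_lt with rfl | hR
  · simp only [kerInt_zero]; exact fun _ _ _ _ _ => le_rfl
  have cont : ∀ x ∈ Ioi (0:ℝ), ContinuousWithinAt (fun x => kerInt α x R) (Ioi 0) x :=
    fun x hx => (continuousAt_left (continuousAt_kerInt h1 hx hR.le)).continuousWithinAt
  have key : ∀ s ⊆ Ioi (0:ℝ), Convex ℝ s → R ∉ interior s →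
      AntitoneOn (fun x => kerInt α x R) s := by
    intro s hs hc hR'
    have hi : ∀ x ∈ interior s, HasDerivAt (fun x => kerInt α x R)
        (-(1/(8*x^4)) * secondMoment α x R) x := fun x hx =>
      hasDerivAt_kerInt_left h1 (hs (interior_subset hx)) hR (fun h => hR' (h ▸ hx))
    refine antitoneOn_of_deriv_nonpos hc (fun x hx => (cont x (hs hx)).mono hs)
      (fun x hx => (hi x hx).differentiableAt.differentiableWithinAt) fun x hx => ?_
    rw [(hi x hx).deriv]
    have := secondMoment_nonneg h0 h1 (hs (interior_subset hx)) hR (fun h => hR' (h ▸ hx))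
    have hx0 : 0 < x := hs (interior_subset hx)
    rw [neg_mul, neg_nonpos]
    positivity
  have e : Ioi (0:ℝ) = Ioc 0 R ∪ Ici R := (Ioc_union_Ici_eq_Ioi hR).symm
  rw [e]
  refine AntitoneOn.union_right (c := R) (key _ (fun x hx => hx.1) (convex_Ioc 0 R) (by simp))
    (key _ (fun x hx => hR.trans_le hx) (convex_Ici R) (by simp)) ?_ ?_
  · exact ⟨⟨hR, le_rfl⟩, fun x hx => hx.2⟩
  · exact ⟨self_mem_Ici, fun x hx => hx⟩

end kernel

section scaling
variable {α : ℝ}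

lemma J0_mul {l x y : ℝ} (hl : 0 < l) (hp : x + y ≠ 0) (hm : x - y ≠ 0) :
    J0 α (l*x) (l*y) = l ^ (1 - 2*α) * J0 α x y := by
  rw [J0, J0, ← mul_add, ← mul_sub]
  simp only [prim0, abs_mul, abs_of_pos hl]
  split_ifs with h
  · rw [Real.log_mul hl.ne' (abs_pos.2 hp).ne', Real.log_mul hl.ne' (abs_pos.2 hm).ne', h]
    norm_num
  · rw [Real.mul_rpow hl.le (abs_nonneg _), Real.mul_rpow hl.le (abs_nonneg _)]; ring

lemma J2_mul {l : ℝ} (hl : 0 < l) (x y : ℝ) :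
    J2 α (l*x) (l*y) = l ^ (3 - 2*α) * J2 α x y := by
  rw [J2, J2, ← mul_add, ← mul_sub]
  simp only [prim2, abs_mul, abs_of_pos hl]
  rw [Real.mul_rpow hl.le (abs_nonneg _), Real.mul_rpow hl.le (abs_nonneg _)]; ring

lemma ker_mul {l x y : ℝ} (hl : 0 < l) (hx : 0 < x) (hy : 0 < y) :
    ker α (l*x) (l*y) = l ^ (1 - 2*α) * ker α x y := by
  by_cases h : x = y
  · simp [ker, h]
  · have h' : l*x ≠ l*y := fun h' => h (mul_left_cancel₀ hl.ne' h')
    rw [ker, ker, if_neg h, if_neg h', kap, kap, J0_mul hl (by positivity) (sub_ne_zero.2 h),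
      J2_mul hl, show 3 - 2*α = 1 - 2*α + 2 by ring, Real.rpow_add hl, Real.rpow_two]
    field_simp

lemma kerInt_eq (h0 : 0 < α) (h1 : α < 1) {x R : ℝ} (hx : 0 < x) (hR : 0 ≤ R) :
    kerInt α x R = ∫ y in (0:ℝ)..R, ker α x y := by
  rw [(integral_ker h0 h1 hx le_rfl hR).2, kerInt_zero, sub_zero]

lemma kerInt_mul (h0 : 0 < α) (h1 : α < 1) {l x R : ℝ} (hl : 0 < l) (hx : 0 < x) (hR : 0 ≤ R) :
    kerInt α (l*x) (l*R) = l ^ (2 - 2*α) * kerInt α x R := by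
  rw [kerInt_eq h0 h1 (by positivity) (by positivity), kerInt_eq h0 h1 hx hR,
    show (0:ℝ) = l * 0 by ring, ← intervalIntegral.mul_integral_comp_mul_left,
    show 2 - 2*α = 1 + (1 - 2*α) by ring, Real.rpow_add hl, Real.rpow_one, mul_assoc, mul_zero]
  congr 1
  rw [← intervalIntegral.integral_const_mul]
  apply intervalIntegral.integral_congr_ae
  refine Eventually.of_forall fun y hy => ?_
  rw [uIoc_of_le hR] at hy
  exact ker_mul hl hx hy.1

lemma kerInt_nonneg (h0 : 0 < α) (h1 : α < 1) {x R : ℝ} (hx : 0 < x) (hR : 0 ≤ R) :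
    0 ≤ kerInt α x R := by
  rw [kerInt_eq h0 h1 hx hR]
  apply intervalIntegral.integral_nonneg_of_ae_restrict hR
  rw [EventuallyLE, ae_restrict_iff' measurableSet_Icc]
  have : ∀ᵐ y : ℝ, y ≠ 0 := by simp [ae_iff]
  filter_upwards [this] with y hy0 hy
  exact ker_nonneg h0 h1 hx (lt_of_le_of_ne hy.1 (Ne.symm hy0))

lemma kerInt_le_of_mul_le (h0 : 0 < α) (h1 : α < 1) {t R m : ℝ} (ht : 0 < t) (hm : 1 < m)
    (hR : m*t ≤ R) : kerInt α t R ≤ t ^ (2 - 2*α) * kerInt α 1 m +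
      2/3*(1+2*α) * (1 - 1/m) ^ (-3 - 2*α) * (R ^ (2 - 2*α) / (2 - 2*α)) := by
  have hm0 : 0 < m := by linarith
  have hmt : 0 < m*t := by positivity
  have e1 : kerInt α t (m*t) = t ^ (2 - 2*α) * kerInt α 1 m := by
    rw [← kerInt_mul h0 h1 ht one_pos hm0.le, mul_one, mul_comm]
  obtain ⟨i1, i2⟩ := integral_ker h0 h1 ht hmt.le hR
  have hs : 0 < 1 - 1/m := by
    rw [sub_pos, div_lt_one hm0]; exact hm
  set C := 2/3*(1+2*α) * (1 - 1/m) ^ (-3 - 2*α) with hC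
  have hC0 : 0 ≤ C := by positivity
  have hint : ∫ y in (m*t)..R, C * y ^ (1 - 2*α) =
      C * ((R ^ (2 - 2*α) - (m*t) ^ (2 - 2*α)) / (2 - 2*α)) := by
    rw [intervalIntegral.integral_const_mul, integral_rpow (Or.inl (by linarith)),
      show 1 - 2*α + 1 = 2 - 2*α by ring]
  have hle : ∫ y in (m*t)..R, ker α t y ≤ ∫ y in (m*t)..R, C * y ^ (1 - 2*α) := by
    apply intervalIntegral.integral_mono_on hR i1
    · exact (intervalIntegral.intervalIntegrable_rpow' (by linarith)).const_mul C
    · intro y hy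
      have hty : t < y := by nlinarith [hy.1]
      have hy0 : 0 < y := ht.trans hty
      refine (ker_le h0 h1 ht hy0 hty.ne).trans ?_
      have hd : y * (1 - 1/m) ≤ |t - y| := by
        rw [abs_of_neg (by linarith)]
        have : t ≤ y / m := by rw [le_div_iff₀ hm0]; linarith [hy.1]
        have : y * (1 - 1/m) = y - y/m := by ring
        linarith
      have h2 : |t - y| ^ (-3 - 2*α) ≤ (y * (1 - 1/m)) ^ (-3 - 2*α) :=
        Real.rpow_le_rpow_of_nonpos (by positivity) hd (by linarith)
      rw [Real.mul_rpow hy0.le hs.le] at h2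
      have h3 : y ^ (1 - 2*α) = y^4 * y ^ (-3 - 2*α) := by
        rw [show 1 - 2*α = -3 - 2*α + (4:ℕ) by push_cast; ring, Real.rpow_add_natCast hy0.ne']
        ring
      rw [h3, hC]
      have := mul_le_mul_of_nonneg_left h2 (show 0 ≤ 2/3*(1+2*α)*y^4 by positivity)
      linarith
  have hpos : 0 ≤ C * ((m*t) ^ (2 - 2*α) / (2 - 2*α)) := by
    have : 0 < 2 - 2*α := by linarith
    positivity
  rw [hint, sub_div, mul_sub] at hle
  linarith

lemma kerInt_le (h0 : 0 < α) (h1 : α < 1) {x R : ℝ} (hx : 0 < x) (hR : 0 ≤ R) :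
    kerInt α x R ≤ 2/3*(1+2*α) * (R ^ (2 - 2*α) / (2 - 2*α)) := by
  rcases hR.eq_or_lt with rfl | hR
  · rw [kerInt_zero, Real.zero_rpow (by linarith)]; simp
  have step : ∀ m : ℝ, 1 < m → kerInt α x R ≤
      2/3*(1+2*α) * (1 - 1/m) ^ (-3 - 2*α) * (R ^ (2 - 2*α) / (2 - 2*α)) := by
    intro m hm
    have hm0 : 0 < m := by linarith
    have hlim : Tendsto (fun t : ℝ => t ^ (2 - 2*α) * kerInt α 1 m +
        2/3*(1+2*α) * (1 - 1/m) ^ (-3 - 2*α) * (R ^ (2 - 2*α) / (2 - 2*α))) (nhdsWithin 0 (Ioi 0))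
        (nhds (0 * kerInt α 1 m +
        2/3*(1+2*α) * (1 - 1/m) ^ (-3 - 2*α) * (R ^ (2 - 2*α) / (2 - 2*α)))) := by
      refine Tendsto.add_const _ (Tendsto.mul_const _ ?_)
      have := (Real.continuousAt_rpow_const 0 (2 - 2*α) (Or.inr (by linarith))).tendsto
      rw [Real.zero_rpow (by linarith)] at this
      exact this.mono_left nhdsWithin_le_nhds
    rw [zero_mul, zero_add] at hlim
    refine ge_of_tendsto hlim ?_
    have : Ioo 0 (min x (R/m)) ∈ nhdsWithin (0:ℝ) (Ioi 0) :=
      Ioo_mem_nhdsGT (by positivity)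
    filter_upwards [this] with t ht
    have ht1 := (lt_min_iff.1 ht.2).1
    have ht2 := (lt_min_iff.1 ht.2).2
    refine (kerInt_antitoneOn h0 h1 hR.le ht.1 hx ht1.le).trans (kerInt_le_of_mul_le h0 h1 ht.1 hm ?_)
    rw [lt_div_iff₀ hm0] at ht2
    linarith
  have hlim : Tendsto (fun m : ℝ => 2/3*(1+2*α) * (1 - 1/m) ^ (-3 - 2*α) *
      (R ^ (2 - 2*α) / (2 - 2*α))) atTop
      (nhds (2/3*(1+2*α) * (1 - 0) ^ (-3 - 2*α) * (R ^ (2 - 2*α) / (2 - 2*α)))) := by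
    refine Tendsto.mul_const _ (Tendsto.const_mul _ ?_)
    refine Tendsto.rpow_const ?_ (Or.inl (by norm_num))
    exact tendsto_const_nhds.sub (tendsto_const_nhds.div_atTop tendsto_id)
  rw [sub_zero, Real.one_rpow, mul_one] at hlim
  exact ge_of_tendsto hlim ((eventually_gt_atTop 1).mono step)

lemma potInt_tendsto_zero (h1 : α < 1) {R : ℝ} (hR : 0 < R) :
    Tendsto (fun x => potInt α x R) (nhdsWithin 0 (Ioi 0)) (nhds (R ^ (2 - 2*α) / (1 - α))) := by
  have hp : (0:ℝ) + R ≠ 0 := by simpa using hR.ne'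
  have hm : (0:ℝ) - R ≠ 0 := by simpa using hR.ne'
  have hodd : oddPow α (-R) = - oddPow α R := by simp [oddPow]
  have z0 : J0 α 0 R = 0 := by simp [J0, prim0]
  have z2 : J2 α 0 R = 0 := by simp [J2, prim2]
  have e2 : HasDerivAt (fun r : ℝ => r^2) (2*0) (0:ℝ) := by simpa using hasDerivAt_pow 2 (0:ℝ)
  have hd : HasDerivAt (fun x => (R^2 - x^2) * J0 α x R + J2 α x R) (4 * (R^2 * oddPow α R)) 0 := by
    refine (((e2.const_sub (R^2)).mul (hasDerivAt_J0_left hp hm)).add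
      (hasDerivAt_J2_left h1 hp hm)).congr_deriv ?_
    simp only [zero_add, zero_sub, hodd, z0]
    ring
  have ht := (hasDerivAt_iff_tendsto_slope_zero.1 hd).mono_left
    (nhdsWithin_mono (0:ℝ) (fun x (hx : 0 < x) => hx.ne'))
  have ht2 := ht.div_const (4 * (1 - α))
  have h1' : 1 - α ≠ 0 := by linarith
  have hval : 4 * (R^2 * oddPow α R) / (4 * (1 - α)) = R ^ (2 - 2*α) / (1 - α) := by
    rw [oddPow_of_pos α hR, show 2 - 2*α = -1 - 2*α + (3:ℕ) by push_cast; ring,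
      Real.rpow_add_natCast hR.ne']
    field_simp
  rw [hval] at ht2
  refine ht2.congr' ?_
  filter_upwards [self_mem_nhdsWithin] with x hx
  have hx' : x ≠ 0 := ne_of_gt hx
  simp only [potInt, z0, z2, zero_add, smul_eq_mul, mul_zero, add_zero, sub_zero]
  field_simp

lemma integral_mul_ker_left (h0 : 0 < α) (h1 : α < 1) {x R : ℝ} (hx : 0 ≤ x) (hR : 0 < R) :
    IntervalIntegrable (fun t => 2*t*ker α t R) volume 0 x ∧ (0 < x →
      ∫ t in (0:ℝ)..x, 2*t*ker α t R = 2*R*(R ^ (2 - 2*α) / (1 - α) - potInt α x R)) := by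
  set G : ℝ → ℝ := Function.update (fun t => -(2*R*potInt α t R)) 0
    (-(2*R*(R ^ (2 - 2*α) / (1 - α)))) with hG
  have hGne : ∀ t, t ≠ 0 → G t = -(2*R*potInt α t R) := fun t ht => by
    rw [hG, Function.update_of_ne ht]
  have hG0 : G 0 = -(2*R*(R ^ (2 - 2*α) / (1 - α))) := by simp [hG]
  have hGeq : ∀ t, t ≠ 0 → G =ᶠ[nhds t] fun t => -(2*R*potInt α t R) := fun t ht => by
    filter_upwards [isOpen_ne.mem_nhds ht] with s hs using hGne s hs
  have main := intervalIntegral_of_hasDerivAt_off_point (G := G)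
    (g := fun t => 2*t*ker α t R) (c := R) hx ?_ ?_ ?_
  · refine ⟨main.1, fun hx => ?_⟩
    rw [main.2, hGne x hx.ne', hG0]; ring
  · intro t ht
    rcases ht.1.eq_or_lt with rfl | ht0
    · have : ContinuousWithinAt G (Ici 0) 0 := by
        rw [hG, continuousWithinAt_update_same]
        have : Ici (0:ℝ) \ {0} = Ioi 0 := by ext; simp [lt_iff_le_and_ne, eq_comm]
        rw [this]
        exact ((potInt_tendsto_zero h1 hR).const_mul (2*R)).neg
      exact this.mono Icc_subset_Ici_self
    · refine ContinuousAt.continuousWithinAt ?_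
      rw [continuousAt_congr (hGeq t ht0.ne')]
      exact ((continuousAt_left (continuousAt_potInt h1 ht0 hR.le)).const_mul (2*R)).neg
  · intro t ht hne
    refine HasDerivAt.congr_of_eventuallyEq ?_ (hGeq t ht.1.ne')
    refine ((hasDerivAt_potInt_left h1 ht.1 hR hne).const_mul (2*R)).neg.congr_deriv ?_
    field_simp
  · exact fun t ht _ => mul_nonneg (by linarith [ht.1]) (ker_nonneg h0 h1 ht.1 hR)

end scaling

/-- Initial segments of `(0,1)` cut out by an antitone function are a.e. intervals. -/
lemma exists_superlevel_ae_eq {q : ℝ → ℝ} (hq : Antitone q) (t : ℝ) :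
    ∃ R ∈ Icc (0:ℝ) 1, (Ioo 0 1 ∩ {y | t < q y} : Set ℝ) =ᵐ[volume] Ioo 0 R := by
  set S : Set ℝ := Ioo 0 1 ∩ {y | t < q y} with hS
  rcases S.eq_empty_or_nonempty with h | hne
  · exact ⟨0, ⟨le_rfl, zero_le_one⟩, by simp [h]⟩
  have hb : BddAbove S := ⟨1, fun y hy => hy.1.2.le⟩
  have hR1 : sSup S ≤ 1 := csSup_le hne fun y hy => hy.1.2.le
  have hR0 : 0 ≤ sSup S := by
    obtain ⟨y, hy⟩ := hne
    exact hy.1.1.le.trans (le_csSup hb hy)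
  refine ⟨sSup S, ⟨hR0, hR1⟩, ?_⟩
  have h1 : Ioo 0 (sSup S) ⊆ S := by
    intro y hy
    obtain ⟨z, hz, hyz⟩ := exists_lt_of_lt_csSup hne hy.2
    exact ⟨⟨hy.1, hy.2.trans_le hR1⟩, lt_of_lt_of_le hz.2 (hq hyz.le)⟩
  have h2 : S ⊆ Ioc 0 (sSup S) := fun y hy => ⟨hy.1.1, le_csSup hb hy⟩
  exact ((LE.le.eventuallyLE h2).trans_eq Ioo_ae_eq_Ioc.symm).antisymm (LE.le.eventuallyLE h1)

/-- If all the initial integrals of `D` are nonnegative, so is its integral against any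
nonnegative bounded antitone function. -/
lemma setIntegral_mul_antitone_nonneg {D q : ℝ → ℝ} {M : ℝ} (hD : IntegrableOn D (Ioo 0 1))
    (hpos : ∀ R ∈ Icc (0:ℝ) 1, 0 ≤ ∫ y in (0:ℝ)..R, D y) (hq : Antitone q)
    (hM : ∀ y, q y ∈ Icc 0 M) : 0 ≤ ∫ y in Ioo (0:ℝ) 1, D y * q y := by
  have hlayer : ∀ y, q y = ∫ t in Ioo (0:ℝ) M, (if t < q y then (1:ℝ) else 0) := by
    intro y
    have e : (fun t => if t < q y then (1:ℝ) else 0) = (Iio (q y)).indicator fun _ => 1 := by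
      funext t; simp [Set.indicator]
    rw [e, setIntegral_indicator measurableSet_Iio]
    have : Ioo (0:ℝ) M ∩ Iio (q y) = Ioo 0 (q y) := by
      ext t; simp only [mem_inter_iff, mem_Ioo, mem_Iio]
      exact ⟨fun h => ⟨h.1.1, h.2⟩, fun h => ⟨⟨h.1, h.2.trans_le (hM y).2⟩, h.2⟩⟩
    rw [this]
    simp [(hM y).1]
  have hint : Integrable (fun p : ℝ × ℝ => D p.1 * (if p.2 < q p.1 then (1:ℝ) else 0))
      ((volume.restrict (Ioo (0:ℝ) 1)).prod (volume.restrict (Ioo (0:ℝ) M))) := by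
    have hf : Integrable (fun p : ℝ × ℝ => D p.1)
      ((volume.restrict (Ioo (0:ℝ) 1)).prod (volume.restrict (Ioo (0:ℝ) M))) := hD.comp_fst _
    refine hf.mul_bdd (c := 1) ?_ ?_
    · refine Measurable.aestronglyMeasurable ?_
      exact Measurable.ite (measurableSet_lt measurable_snd (hq.measurable.comp measurable_fst))
        measurable_const measurable_const
    · refine Eventually.of_forall fun p => ?_
      split_ifs <;> simp
  calc (0:ℝ) ≤ ∫ t in Ioo (0:ℝ) M, ∫ y in Ioo (0:ℝ) 1, D y * (if t < q y then (1:ℝ) else 0) := by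
        refine integral_nonneg fun t => ?_
        obtain ⟨R, hR, hae⟩ := exists_superlevel_ae_eq hq t
        have e : (fun y => D y * (if t < q y then (1:ℝ) else 0)) =
            ({y | t < q y} : Set ℝ).indicator D := by
          funext y; simp [Set.indicator]
        have hms : MeasurableSet {y | t < q y} := measurableSet_lt measurable_const hq.measurable
        simp only [e]
        rw [setIntegral_indicator hms, setIntegral_congr_set hae, ← integral_Ioc_eq_integral_Ioo,
          ← intervalIntegral.integral_of_le hR.1]
        exact hpos R hR
    _ = ∫ y in Ioo (0:ℝ) 1, ∫ t in Ioo (0:ℝ) M, D y * (if t < q y then (1:ℝ) else 0) :=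
        (integral_integral_swap hint).symm
    _ = ∫ y in Ioo (0:ℝ) 1, D y * q y := by
        refine integral_congr_ae (Eventually.of_forall fun y => ?_)
        simp only
        rw [integral_const_mul, ← hlayer]

section operator
variable {α : ℝ}

lemma measurable_ker (α : ℝ) : Measurable fun p : ℝ × ℝ => ker α p.1 p.2 := by
  have m0 : Measurable (prim0 α) := by
    unfold prim0
    split_ifs <;> fun_prop
  have m2 : Measurable (prim2 α) := by unfold prim2; fun_prop
  unfold ker kap J0 J2
  exact Measurable.ite (measurableSet_eq_fun measurable_fst measurable_snd) measurable_const
    (by fun_prop)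

/-- The linear operator with kernel `ker` on `(0,1)`. -/
def kop (α : ℝ) (q : ℝ → ℝ) (x : ℝ) : ℝ := ∫ y in Ioo (0:ℝ) 1, ker α x y * q y

lemma integrableOn_ker (h0 : 0 < α) (h1 : α < 1) {x R : ℝ} (hx : 0 < x) (hR : 0 ≤ R) :
    IntegrableOn (ker α x) (Ioo 0 R) :=
  ((intervalIntegrable_iff_integrableOn_Ioc_of_le hR).1
    (integral_ker h0 h1 hx le_rfl hR).1).mono_set Ioo_subset_Ioc_self

lemma integrableOn_rpow_Ioo (h1 : α < 1) {R : ℝ} (hR : 0 ≤ R) :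
    IntegrableOn (fun y : ℝ => y ^ (1 - 2*α)) (Ioo 0 R) :=
  ((intervalIntegrable_iff_integrableOn_Ioc_of_le hR).1
    (intervalIntegral.intervalIntegrable_rpow' (by linarith))).mono_set Ioo_subset_Ioc_self

lemma integrableOn_mul_antitone {D q : ℝ → ℝ} {s : Set ℝ} {M : ℝ}
    (hD : IntegrableOn D s) (hq : Antitone q) (hM : ∀ y, q y ∈ Icc 0 M) :
    IntegrableOn (fun y => D y * q y) s :=
  hD.mul_bdd (c := M) hq.measurable.aestronglyMeasurable
    (Eventually.of_forall fun y => by rw [Real.norm_of_nonneg (hM y).1]; exact (hM y).2)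

lemma kop_antitoneOn (h0 : 0 < α) (h1 : α < 1) {q : ℝ → ℝ} {M : ℝ} (hq : Antitone q)
    (hM : ∀ y, q y ∈ Icc 0 M) : AntitoneOn (kop α q) (Ioi 0) := by
  intro x hx z hz hxz
  have ix := integrableOn_ker h0 h1 hx zero_le_one
  have iz := integrableOn_ker h0 h1 hz zero_le_one
  have := setIntegral_mul_antitone_nonneg (D := fun y => ker α x y - ker α z y) (ix.sub iz) ?_ hq hM
  · simp only [sub_mul] at this
    rw [integral_sub (integrableOn_mul_antitone ix hq hM) (integrableOn_mul_antitone iz hq hM),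
      sub_nonneg] at this
    exact this
  · intro R hR
    rw [intervalIntegral.integral_sub (integral_ker h0 h1 hx le_rfl hR.1).1
      (integral_ker h0 h1 hz le_rfl hR.1).1, ← kerInt_eq h0 h1 hx hR.1, ← kerInt_eq h0 h1 hz hR.1,
      sub_nonneg]
    exact kerInt_antitoneOn h0 h1 hR.1 hx hz hxz

lemma kop_nonneg (h0 : 0 < α) (h1 : α < 1) {q : ℝ → ℝ} {M x : ℝ}
    (hM : ∀ y, q y ∈ Icc 0 M) (hx : 0 < x) : 0 ≤ kop α q x :=
  setIntegral_nonneg measurableSet_Ioo fun y hy =>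
    mul_nonneg (ker_nonneg h0 h1 hx hy.1) (hM y).1

lemma kop_le (h0 : 0 < α) (h1 : α < 1) {q : ℝ → ℝ} {M x : ℝ} (hq : Antitone q)
    (hM : ∀ y, q y ∈ Icc 0 M) (hx : 0 < x) :
    kop α q x ≤ 2/3*(1+2*α) * ∫ y in Ioo (0:ℝ) 1, q y * y ^ (1 - 2*α) := by
  have ix := integrableOn_ker h0 h1 hx zero_le_one
  have ir := (integrableOn_rpow_Ioo h1 zero_le_one).const_mul (2/3*(1+2*α))
  have := setIntegral_mul_antitone_nonneg
    (D := fun y => 2/3*(1+2*α) * y ^ (1 - 2*α) - ker α x y) (ir.sub ix) ?_ hq hM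
  · simp only [sub_mul] at this
    rw [integral_sub (integrableOn_mul_antitone ir hq hM) (integrableOn_mul_antitone ix hq hM),
      sub_nonneg] at this
    refine this.trans (le_of_eq ?_)
    rw [← integral_const_mul]
    congr 1; funext y; ring
  · intro R hR
    rw [intervalIntegral.integral_sub ((intervalIntegral.intervalIntegrable_rpow'
      (by linarith)).const_mul _) (integral_ker h0 h1 hx le_rfl hR.1).1, ← kerInt_eq h0 h1 hx hR.1,
      intervalIntegral.integral_const_mul, integral_rpow (Or.inl (by linarith)),
      show 1 - 2*α + 1 = 2 - 2*α by ring, Real.zero_rpow (by linarith), sub_zero, sub_nonneg]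
    exact kerInt_le h0 h1 hx hR.1

end operator

/-- Antitone functions with values in `[0,M]`. -/
def antitoneClass (M : ℝ) : Set (ℝ → ℝ) := {q | Antitone q ∧ ∀ y, q y ∈ Icc 0 M}

lemma isClosed_antitoneClass (M : ℝ) : IsClosed (antitoneClass M) := by
  have e : antitoneClass M = (⋂ (a : ℝ) (b : ℝ) (_ : a ≤ b), {q : ℝ → ℝ | q b ≤ q a}) ∩
      ⋂ y : ℝ, {q : ℝ → ℝ | q y ∈ Icc 0 M} := by
    ext q; simp [antitoneClass, Antitone]
  rw [e]
  refine IsClosed.inter (isClosed_iInter fun a => isClosed_iInter fun b => isClosed_iInter fun _ =>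
    isClosed_le (continuous_apply b) (continuous_apply a)) (isClosed_iInter fun y => ?_)
  exact isClosed_Icc.preimage (continuous_apply y)

lemma isCompact_antitoneClass (M : ℝ) : IsCompact (antitoneClass M) := by
  refine (isCompact_univ_pi fun _ : ℝ => isCompact_Icc (a := (0:ℝ)) (b := M)).of_isClosed_subset
    (isClosed_antitoneClass M) fun q hq => ?_
  exact fun y _ => hq.2 y

/-- Helly's selection theorem for antitone functions. -/
lemma exists_subseq_ae_tendsto {M : ℝ} {u : ℕ → ℝ → ℝ} (hu : ∀ k, u k ∈ antitoneClass M) :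
    ∃ q ∈ antitoneClass M, ∃ φ : ℕ → ℕ, StrictMono φ ∧
      ∀ᵐ x : ℝ, Tendsto (fun k => u (φ k) x) atTop (nhds (q x)) := by
  obtain ⟨q, hq, hc⟩ := (isCompact_antitoneClass M).exists_mapClusterPt (f := atTop) (u := u)
    (le_principal_iff.2 (mem_map.2 (univ_mem' hu)))
  have hr : Continuous fun (f : ℝ → ℝ) (r : ℚ) => f r := by fun_prop
  obtain ⟨φ, hφ, ht⟩ := (hc.continuousAt_comp hr.continuousAt).tendsto_subseq
  rw [tendsto_pi_nhds] at ht
  refine ⟨q, hq, φ, hφ, ?_⟩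
  have hcount : {x | ¬ ContinuousAt q x}.Countable := hq.1.countable_not_continuousAt
  filter_upwards [hcount.ae_notMem volume] with x hx
  replace hx : ContinuousAt q x := not_not.1 hx
  rw [tendsto_order]
  constructor
  · intro a ha
    have : ∀ᶠ y in nhdsWithin x (Ioi x), a < q y :=
      (hx.tendsto.mono_left nhdsWithin_le_nhds).eventually_const_lt ha
    obtain ⟨z, hz, hz2⟩ := (mem_nhdsGT_iff_exists_Ioo_subset).1 this
    obtain ⟨r, hr1, hr2⟩ := exists_rat_btwn (mem_Ioi.1 hz)
    filter_upwards [(ht r).eventually_const_lt (hz2 ⟨hr1, hr2⟩)] with k hk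
    exact hk.trans_le ((hu (φ k)).1 hr1.le)
  · intro a ha
    have : ∀ᶠ y in nhdsWithin x (Iio x), q y < a :=
      (hx.tendsto.mono_left nhdsWithin_le_nhds).eventually_lt_const ha
    obtain ⟨z, hz, hz2⟩ := (mem_nhdsLT_iff_exists_Ioo_subset).1 this
    obtain ⟨r, hr1, hr2⟩ := exists_rat_btwn (mem_Iio.1 hz)
    filter_upwards [(ht r).eventually_lt_const (hz2 ⟨hr1, hr2⟩)] with k hk
    exact ((hu (φ k)).1 hr2.le).trans_lt hk

section energy
variable {α : ℝ}

/-- Lebesgue measure on the unit square `(0,1)²`. -/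
def sqMeasure : Measure (ℝ × ℝ) :=
  (volume.restrict (Ioo (0:ℝ) 1)).prod (volume.restrict (Ioo (0:ℝ) 1))

lemma ae_sqMeasure_mem : ∀ᵐ p ∂sqMeasure, p.1 ∈ Ioo (0:ℝ) 1 ∧ p.2 ∈ Ioo (0:ℝ) 1 := by
  rw [sqMeasure, Measure.prod_restrict]
  filter_upwards [ae_restrict_mem (measurableSet_Ioo.prod measurableSet_Ioo)] with p hp using hp

lemma integrable_symKer (h0 : 0 < α) (h1 : α < 1) :
    Integrable (fun p : ℝ × ℝ => p.1^4 * ker α p.1 p.2) sqMeasure := by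
  have hm : Measurable fun p : ℝ × ℝ => p.1^4 * ker α p.1 p.2 :=
    (by fun_prop : Measurable fun p : ℝ × ℝ => p.1^4).mul (measurable_ker α)
  rw [sqMeasure, integrable_prod_iff hm.aestronglyMeasurable]
  constructor
  · filter_upwards [ae_restrict_mem measurableSet_Ioo] with x hx
    exact (integrableOn_ker h0 h1 hx.1 zero_le_one).const_mul _
  · have hb : IntegrableOn (fun x : ℝ => 2/3*(1+2*α) * (1 / (2 - 2*α))) (Ioo 0 1) :=
      integrable_const _
    refine hb.mono' ?_ ?_
    · exact hm.stronglyMeasurable.norm.integral_prod_right'.aestronglyMeasurable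
    · filter_upwards [ae_restrict_mem measurableSet_Ioo] with x hx
      have e : ∫ y in Ioo (0:ℝ) 1, ‖x^4 * ker α x y‖ = x^4 * kerInt α x 1 := by
        rw [kerInt_eq h0 h1 hx.1 zero_le_one, intervalIntegral.integral_of_le zero_le_one,
          integral_Ioc_eq_integral_Ioo, ← integral_const_mul]
        refine setIntegral_congr_fun measurableSet_Ioo fun y hy => ?_
        have := ker_nonneg h0 h1 hx.1 hy.1
        exact Real.norm_of_nonneg (by positivity)
      have h2 := kerInt_nonneg h0 h1 hx.1 zero_le_one
      have h3 := kerInt_le h0 h1 hx.1 zero_le_one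
      rw [Real.one_rpow] at h3
      rw [e, Real.norm_of_nonneg (by positivity)]
      refine le_trans ?_ h3
      exact mul_le_of_le_one_left h2 (pow_le_one₀ hx.1.le hx.2.le)

/-- The symmetric bilinear form of the operator `kop` with respect to the weight `x⁴`. -/
def form (α : ℝ) (q r : ℝ → ℝ) : ℝ := ∫ p, p.1^4 * ker α p.1 p.2 * (q p.2 * r p.1) ∂sqMeasure

lemma integrable_symKer_mul (h0 : 0 < α) (h1 : α < 1) {q r : ℝ → ℝ} {M : ℝ} (hq : Measurable q)
    (hr : Measurable r) (hqM : ∀ y, |q y| ≤ M) (hrM : ∀ y, |r y| ≤ M) :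
    Integrable (fun p : ℝ × ℝ => p.1^4 * ker α p.1 p.2 * (q p.2 * r p.1)) sqMeasure := by
  refine (integrable_symKer h0 h1).mul_bdd (c := M * M) (by fun_prop)
    (Eventually.of_forall fun p => ?_)
  rw [norm_mul]
  exact mul_le_mul (hqM _) (hrM _) (norm_nonneg _) ((abs_nonneg _).trans (hqM 0))

lemma form_comm (α : ℝ) (q r : ℝ → ℝ) : form α q r = form α r q := by
  rw [form, form, sqMeasure, ← integral_prod_swap]
  refine integral_congr_ae ?_
  filter_upwards [ae_sqMeasure_mem] with p hp
  simp only [Prod.fst_swap, Prod.snd_swap]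
  rw [pow_mul_ker_comm hp.2.1 hp.1.1]
  ring

lemma form_eq_kop (h0 : 0 < α) (h1 : α < 1) {q r : ℝ → ℝ} {M : ℝ} (hq : Measurable q)
    (hr : Measurable r) (hqM : ∀ y, |q y| ≤ M) (hrM : ∀ y, |r y| ≤ M) :
    form α q r = ∫ x in Ioo (0:ℝ) 1, x^4 * kop α q x * r x := by
  have hi := integrable_symKer_mul h0 h1 hq hr hqM hrM
  rw [sqMeasure] at hi
  rw [form, sqMeasure, integral_prod _ hi]
  congr 1; funext x
  rw [kop, mul_assoc, ← integral_mul_const, ← integral_const_mul]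
  congr 1; funext y; ring

/-- The weighted `L²` norm squared. -/
def mass (q : ℝ → ℝ) : ℝ := ∫ x in Ioo (0:ℝ) 1, x^4 * q x ^ 2

/-- The functional whose maximisers are eigenfunctions of `kop`. -/
def energy (α N : ℝ) (q : ℝ → ℝ) : ℝ := N/2 * form α q q - mass q / 2 - mass q ^ 2 / 4

lemma tendsto_energy (h0 : 0 < α) (h1 : α < 1) (N : ℝ) {M : ℝ} {u : ℕ → ℝ → ℝ} {q : ℝ → ℝ}
    (hu : ∀ k, u k ∈ antitoneClass M)
    (ht : ∀ᵐ x : ℝ, Tendsto (fun k => u k x) atTop (nhds (q x))) :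
    Tendsto (fun k => energy α N (u k)) atTop (nhds (energy α N q)) := by
  have hM : 0 ≤ M := ((hu 0).2 0).1.trans ((hu 0).2 0).2
  have hb : ∀ k y, |u k y| ≤ M := fun k y => by
    rw [abs_of_nonneg ((hu k).2 y).1]; exact ((hu k).2 y).2
  have ht' : ∀ᵐ x ∂(volume.restrict (Ioo (0:ℝ) 1)), Tendsto (fun k => u k x) atTop (nhds (q x)) :=
    ae_restrict_of_ae ht
  have t1 : Tendsto (fun k => mass (u k)) atTop (nhds (mass q)) := by
    refine tendsto_integral_of_dominated_convergence (fun _ => M^2) ?_ ?_ ?_ ?_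
    · intro k
      have := (hu k).1.measurable
      exact Measurable.aestronglyMeasurable (by fun_prop)
    · exact integrable_const _
    · intro k
      filter_upwards [ae_restrict_mem measurableSet_Ioo] with x hx
      rw [norm_mul, norm_pow, norm_pow]
      have h1 : ‖x‖ ^ 4 ≤ 1 := by
        rw [Real.norm_of_nonneg hx.1.le]; exact pow_le_one₀ hx.1.le hx.2.le
      have h2 : ‖u k x‖^2 ≤ M^2 := pow_le_pow_left₀ (norm_nonneg _) (hb k x) 2
      calc _ ≤ 1 * M^2 := mul_le_mul h1 h2 (by positivity) zero_le_one
        _ = M^2 := one_mul _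
    · filter_upwards [ht'] with x hx
      exact (hx.pow 2).const_mul _
  have t2 : Tendsto (fun k => form α (u k) (u k)) atTop (nhds (form α q q)) := by
    refine tendsto_integral_of_dominated_convergence
      (fun p => ‖p.1^4 * ker α p.1 p.2‖ * (M * M)) ?_ ?_ ?_ ?_
    · intro k
      exact (integrable_symKer_mul h0 h1 (hu k).1.measurable (hu k).1.measurable (hb k)
        (hb k)).aestronglyMeasurable
    · exact (integrable_symKer h0 h1).norm.mul_const _
    · intro k
      refine Eventually.of_forall fun p => ?_
      rw [norm_mul, norm_mul (u k p.2)]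
      gcongr
      · exact hb k _
      · exact hb k _
    · have hf : ∀ᵐ p ∂sqMeasure, Tendsto (fun k => u k p.1) atTop (nhds (q p.1)) :=
        Measure.quasiMeasurePreserving_fst.ae ht'
      have hs : ∀ᵐ p ∂sqMeasure, Tendsto (fun k => u k p.2) atTop (nhds (q p.2)) :=
        Measure.quasiMeasurePreserving_snd.ae ht'
      filter_upwards [hf, hs] with p hp1 hp2
      exact (hp2.mul hp1).const_mul _
  exact ((t2.const_mul _).sub (t1.div_const 2)).sub ((t1.pow 2).div_const 4)

lemma exists_energy_max (h0 : 0 < α) (h1 : α < 1) (N : ℝ) {M : ℝ} (hM : 0 ≤ M) :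
    ∃ q ∈ antitoneClass M, ∀ r ∈ antitoneClass M, energy α N r ≤ energy α N q := by
  have hne : (energy α N '' antitoneClass M).Nonempty :=
    ⟨_, fun _ => 0, ⟨fun _ _ _ => le_rfl, fun _ => ⟨le_rfl, hM⟩⟩, rfl⟩
  have hbd : BddAbove (energy α N '' antitoneClass M) := by
    by_contra hnb
    rw [not_bddAbove_iff] at hnb
    have : ∀ k : ℕ, ∃ q ∈ antitoneClass M, (k:ℝ) < energy α N q := fun k => by
      obtain ⟨_, ⟨q, hq, rfl⟩, h⟩ := hnb k
      exact ⟨q, hq, h⟩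
    choose u hu hk using this
    obtain ⟨q, -, φ, hφ, ht⟩ := exists_subseq_ae_tendsto hu
    have h := tendsto_energy h0 h1 N (fun k => hu (φ k)) ht
    refine not_tendsto_atTop_of_tendsto_nhds h (tendsto_atTop_mono (fun k => (hk (φ k)).le) ?_)
    exact tendsto_natCast_atTop_atTop.comp hφ.tendsto_atTop
  obtain ⟨v, -, hv, hvm⟩ := exists_seq_tendsto_sSup hne hbd
  choose u hu hk using hvm
  obtain ⟨q, hq, φ, hφ, ht⟩ := exists_subseq_ae_tendsto hu
  have h := tendsto_energy h0 h1 N (fun k => hu (φ k)) ht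
  simp only [hk] at h
  have := tendsto_nhds_unique h (hv.comp hφ.tendsto_atTop)
  exact ⟨q, hq, fun r hr => this ▸ le_csSup hbd ⟨r, hr, rfl⟩⟩

end energy

section variational
variable {α : ℝ}

lemma kerInt_one_one (h1 : α < 1) : kerInt α 1 1 =
    (2:ℝ) ^ (2 - 2*α) * (1 + 2*α) / ((2 - 2*α) * (3 - 2*α) * (5 - 2*α)) := by
  have e3 : (2:ℝ) ^ (3 - 2*α) = 2 * 2 ^ (2 - 2*α) := by
    rw [show 3 - 2*α = 2 - 2*α + 1 by ring, Real.rpow_add_one (by norm_num)]; ring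
  have e5 : (2:ℝ) ^ (5 - 2*α) = 8 * 2 ^ (2 - 2*α) := by
    rw [show 5 - 2*α = 2 - 2*α + (3:ℕ) by push_cast; ring, Real.rpow_add_natCast (by norm_num)]
    norm_num; ring
  have a1 : 1 - α ≠ 0 := by linarith
  have a2 : 2 - 2*α ≠ 0 := by linarith
  have a3 : 3 - 2*α ≠ 0 := by linarith
  have a5 : 5 - 2*α ≠ 0 := by linarith
  have z3 : |(1:ℝ) - 1| ^ (3 - 2*α) = 0 := by rw [sub_self, abs_zero, Real.zero_rpow a3]
  have z5 : |(1:ℝ) - 1| ^ (5 - 2*α) = 0 := by rw [sub_self, abs_zero, Real.zero_rpow a5]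
  have e2 : |(1:ℝ) + 1| = 2 := by norm_num
  simp only [kerInt, J2, J4, prim2, prim4, z3, z5, e2, e3, e5]
  field_simp
  ring

lemma kerInt_one_one_pos (h0 : 0 < α) (h1 : α < 1) : 0 < kerInt α 1 1 := by
  rw [kerInt_one_one h1]
  have a2 : 0 < 2 - 2*α := by linarith
  have a3 : 0 < 3 - 2*α := by linarith
  have a5 : 0 < 5 - 2*α := by linarith
  positivity

lemma integrableOn_pow_mul {f : ℝ → ℝ} {M : ℝ} (hf : Measurable f) (hM : ∀ y, |f y| ≤ M) :
    IntegrableOn (fun x : ℝ => x^4 * f x) (Ioo 0 1) := by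
  have : IntegrableOn (fun x : ℝ => x^4) (Ioo 0 1) :=
    ((continuous_pow 4).integrableOn_Icc (a := (0:ℝ)) (b := 1)).mono_set Ioo_subset_Icc_self
  exact this.mul_bdd (c := M) hf.aestronglyMeasurable (Eventually.of_forall hM)

lemma integral_pow_four {R : ℝ} (hR : 0 ≤ R) : ∫ x in Ioo (0:ℝ) R, x^4 = R^5/5 := by
  rw [← integral_Ioc_eq_integral_Ioo, ← intervalIntegral.integral_of_le hR, integral_pow]
  norm_num

lemma mass_nonneg (q : ℝ → ℝ) : 0 ≤ mass q :=
  setIntegral_nonneg measurableSet_Ioo fun x _ => by positivity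

lemma abs_le_of_mem_antitoneClass {M : ℝ} {q : ℝ → ℝ} (hq : q ∈ antitoneClass M) (y : ℝ) :
    |q y| ≤ M := by
  rw [abs_of_nonneg (hq.2 y).1]; exact (hq.2 y).2

lemma integrableOn_mass {M : ℝ} {q : ℝ → ℝ} (hq : Measurable q) (hM : ∀ y, |q y| ≤ M) :
    IntegrableOn (fun x : ℝ => x^4 * q x ^ 2) (Ioo 0 1) :=
  integrableOn_pow_mul (M := M^2) (hq.pow_const 2) fun y => by
    rw [abs_pow]; exact pow_le_pow_left₀ (abs_nonneg _) (hM y) 2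

lemma le_mass {M δ : ℝ} {q : ℝ → ℝ} (hq : q ∈ antitoneClass M) (hδ : δ ∈ Ioo (0:ℝ) 1) :
    q δ ^ 2 * (δ^5/5) ≤ mass q := by
  have hi := integrableOn_mass hq.1.measurable (abs_le_of_mem_antitoneClass hq)
  rw [← integral_pow_four hδ.1.le, ← integral_const_mul]
  calc ∫ x in Ioo (0:ℝ) δ, q δ ^ 2 * x^4 ≤ ∫ x in Ioo (0:ℝ) δ, x^4 * q x ^ 2 := by
        refine setIntegral_mono_on ?_ (hi.mono_set (Ioo_subset_Ioo_right hδ.2.le))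
          measurableSet_Ioo fun x hx => ?_
        · exact (((continuous_pow 4).const_mul _).integrableOn_Icc
            (a := (0:ℝ)) (b := δ)).mono_set Ioo_subset_Icc_self
        · have := pow_le_pow_left₀ (hq.2 δ).1 (hq.1 hx.2.le) 2
          nlinarith [pow_nonneg hx.1.le 4]
    _ ≤ mass q := setIntegral_mono_set hi
        (Eventually.of_forall fun x => mul_nonneg (by positivity) (by positivity))
        (LE.le.eventuallyLE (Ioo_subset_Ioo_right hδ.2.le))

lemma integral_rpow_Ioo (h1 : α < 1) {R : ℝ} (hR : 0 ≤ R) :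
    ∫ y in Ioo (0:ℝ) R, y ^ (1 - 2*α) = R ^ (2 - 2*α) / (2 - 2*α) := by
  rw [← integral_Ioc_eq_integral_Ioo, ← intervalIntegral.integral_of_le hR,
    integral_rpow (Or.inl (by linarith)), show 1 - 2*α + 1 = 2 - 2*α by ring,
    Real.zero_rpow (by linarith), sub_zero]

lemma kop_le_of_mem (h0 : 0 < α) (h1 : α < 1) {M δ x : ℝ} {q : ℝ → ℝ} (hq : q ∈ antitoneClass M)
    (hδ : δ ∈ Ioo (0:ℝ) 1) (hx : 0 < x) :
    kop α q x ≤ 2/3*(1+2*α) / (2 - 2*α) * (M * δ ^ (2 - 2*α) + q δ) := by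
  refine (kop_le h0 h1 hq.1 hq.2 hx).trans ?_
  have hM : 0 ≤ M := (hq.2 0).1.trans (hq.2 0).2
  have i1 := integrableOn_rpow_Ioo h1 (zero_le_one (α := ℝ))
  have ind : ∀ y : ℝ, (Iio δ).indicator (fun y : ℝ => y ^ (1 - 2*α)) y =
      if y < δ then y ^ (1 - 2*α) else 0 := fun y => by simp [Set.indicator]
  have hle : ∫ y in Ioo (0:ℝ) 1, q y * y ^ (1 - 2*α) ≤ ∫ y in Ioo (0:ℝ) 1,
      (M * (Iio δ).indicator (fun y : ℝ => y ^ (1 - 2*α)) y + q δ * y ^ (1 - 2*α)) := by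
    refine setIntegral_mono_on ?_ ?_ measurableSet_Ioo fun y hy => ?_
    · simpa only [mul_comm] using integrableOn_mul_antitone i1 hq.1 hq.2
    · exact ((i1.indicator measurableSet_Iio).const_mul M).add (i1.const_mul _)
    · have hy0 : 0 ≤ y ^ (1 - 2*α) := Real.rpow_nonneg hy.1.le _
      rw [ind]
      split_ifs with h
      · nlinarith [mul_le_mul_of_nonneg_right (hq.2 y).2 hy0, mul_nonneg (hq.2 δ).1 hy0]
      · nlinarith [mul_le_mul_of_nonneg_right (hq.1 (not_lt.1 h)) hy0]
  have hval : ∫ y in Ioo (0:ℝ) 1, (M * (Iio δ).indicator (fun y : ℝ => y ^ (1 - 2*α)) y +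
      q δ * y ^ (1 - 2*α)) = (M * δ ^ (2 - 2*α) + q δ) / (2 - 2*α) := by
    rw [integral_add ((i1.indicator measurableSet_Iio).const_mul M) (i1.const_mul _),
      integral_const_mul, integral_const_mul, setIntegral_indicator measurableSet_Iio,
      integral_rpow_Ioo h1 zero_le_one, Real.one_rpow]
    have : Ioo (0:ℝ) 1 ∩ Iio δ = Ioo 0 δ := by
      rw [Ioo_inter_Iio, min_eq_right hδ.2.le]
    rw [this, integral_rpow_Ioo h1 hδ.1.le]
    ring
  rw [hval] at hle
  calc _ ≤ 2/3*(1+2*α) * ((M * δ ^ (2 - 2*α) + q δ) / (2 - 2*α)) := by gcongr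
    _ = _ := by ring

/-- A bound `M` for which the eigenvalue iteration preserves `antitoneClass M`. -/
lemma exists_invariant_bound (h0 : 0 < α) (h1 : α < 1) {N : ℝ} (hN : 0 < N) :
    ∃ M : ℝ, 0 < M ∧ ∀ q ∈ antitoneClass M, ∀ x > 0, N * kop α q x / (1 + mass q) ≤ M := by
  have h2 : 0 < 2 - 2*α := by linarith
  set a := N * (2/3*(1+2*α) / (2 - 2*α)) with ha
  have ha0 : 0 < a := by positivity
  obtain ⟨δ, hδ, hδa⟩ : ∃ δ ∈ Ioo (0:ℝ) 1, a * δ ^ (2 - 2*α) < 1/2 := by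
    have ht : Tendsto (fun δ : ℝ => a * δ ^ (2 - 2*α)) (nhdsWithin 0 (Ioi 0)) (nhds 0) := by
      have := ((Real.continuousAt_rpow_const 0 (2 - 2*α) (Or.inr h2.le)).tendsto).const_mul a
      rw [Real.zero_rpow h2.ne', mul_zero] at this
      exact this.mono_left nhdsWithin_le_nhds
    obtain ⟨δ, hd1, hd2⟩ := ((ht.eventually_lt_const (by norm_num : (0:ℝ) < 1/2)).and
      (Ioo_mem_nhdsGT (zero_lt_one (α := ℝ)))).exists
    exact ⟨δ, hd2, hd1⟩
  have hδ5 : 0 < δ^5 := pow_pos hδ.1 5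
  have hδ1 : δ^5 ≤ 1 := pow_le_one₀ hδ.1.le hδ.2.le
  refine ⟨2*a*(5/δ^5), by positivity, fun q hq x hx => ?_⟩
  set M := 2*a*(5/δ^5) with hM
  have hm := mass_nonneg q
  rw [div_le_iff₀ (by positivity)]
  have b1 : N * kop α q x ≤ a * (M * δ ^ (2 - 2*α) + q δ) := by
    rw [ha, mul_assoc]
    exact mul_le_mul_of_nonneg_left (kop_le_of_mem h0 h1 hq hδ hx) hN.le
  have b2 : q δ ≤ 5/δ^5 * (1 + mass q) := by
    have h := le_mass hq hδ
    rw [div_mul_eq_mul_div, le_div_iff₀ hδ5]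
    nlinarith [sq_nonneg (q δ - 1), sq_nonneg (q δ), (hq.2 δ).1]
  have hM0 : 0 < M := by positivity
  have b3 : a * (M * δ ^ (2 - 2*α)) ≤ M/2 := by nlinarith
  have b4 : a * q δ ≤ M/2 * (1 + mass q) := by
    have := mul_le_mul_of_nonneg_left b2 ha0.le
    have e : M/2 * (1 + mass q) = a * (5/δ^5 * (1 + mass q)) := by rw [hM]; ring
    linarith
  nlinarith

lemma mass_add (q v : ℝ → ℝ) {M : ℝ} (hq : Measurable q) (hv : Measurable v)
    (hqM : ∀ y, |q y| ≤ M) (hvM : ∀ y, |v y| ≤ M) (t : ℝ) :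
    mass (fun x => q x + t * v x) =
      mass q + 2*t*(∫ x in Ioo (0:ℝ) 1, x^4 * (q x * v x)) + t^2 * mass v := by
  have i1 := integrableOn_mass hq hqM
  have i2 := integrableOn_mass hv hvM
  have i3 : IntegrableOn (fun x : ℝ => x^4 * (q x * v x)) (Ioo 0 1) :=
    integrableOn_pow_mul (M := M*M) (hq.mul hv) fun y => by
      rw [abs_mul]; exact mul_le_mul (hqM y) (hvM y) (abs_nonneg _) ((abs_nonneg _).trans (hqM y))
  have i13 : IntegrableOn (fun x : ℝ => x^4 * q x^2 + 2*t*(x^4 * (q x * v x))) (Ioo 0 1) :=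
    i1.add (i3.const_mul _)
  rw [mass, mass, mass, ← integral_const_mul, ← integral_const_mul,
    ← integral_add i1 (i3.const_mul _), ← integral_add i13 (i2.const_mul _)]
  congr 1; funext x; ring

lemma form_add (h0 : 0 < α) (h1 : α < 1) (q v : ℝ → ℝ) {M : ℝ} (hq : Measurable q)
    (hv : Measurable v) (hqM : ∀ y, |q y| ≤ M) (hvM : ∀ y, |v y| ≤ M) (t : ℝ) :
    form α (fun x => q x + t * v x) (fun x => q x + t * v x) =
      form α q q + 2*t*form α q v + t^2 * form α v v := by
  have i1 := integrable_symKer_mul h0 h1 hq hq hqM hqM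
  have i2 := integrable_symKer_mul h0 h1 hq hv hqM hvM
  have i3 := integrable_symKer_mul h0 h1 hv hq hvM hqM
  have i4 := integrable_symKer_mul h0 h1 hv hv hvM hvM
  have e : 2*t*form α q v = t*form α q v + t*form α v q := by
    rw [form_comm α v q]; ring
  have i23 : Integrable (fun p : ℝ × ℝ => t*(p.1^4 * ker α p.1 p.2 * (q p.2 * v p.1)) +
      t*(p.1^4 * ker α p.1 p.2 * (v p.2 * q p.1))) sqMeasure :=
    (i2.const_mul _).add (i3.const_mul _)
  have i123 : Integrable (fun p : ℝ × ℝ => p.1^4 * ker α p.1 p.2 * (q p.2 * q p.1) +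
      (t*(p.1^4 * ker α p.1 p.2 * (q p.2 * v p.1)) +
      t*(p.1^4 * ker α p.1 p.2 * (v p.2 * q p.1)))) sqMeasure := i1.add i23
  rw [e, form, form, form, form, form, ← integral_const_mul, ← integral_const_mul,
    ← integral_const_mul, ← integral_add (i2.const_mul _) (i3.const_mul _), ← integral_add i1 i23,
    ← integral_add i123 (i4.const_mul _)]
  congr 1; funext p; ring

lemma energy_const_pos (h0 : 0 < α) (h1 : α < 1) {t : ℝ} (ht : t ∈ Ioc (0:ℝ) 1) :
    0 < energy α (3 / (2 * kerInt α 1 1)) (fun _ => t) := by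
  have hχ := kerInt_one_one_pos h0 h1
  set χ := kerInt α 1 1 with hχdef
  have hm : mass (fun _ => t) = t^2/5 := by
    rw [mass, integral_mul_const, integral_pow_four zero_le_one]; ring
  have hf : t^2 * (χ/5) ≤ form α (fun _ => t) (fun _ => t) := by
    rw [form_eq_kop h0 h1 (M := |t|) measurable_const measurable_const (fun _ => le_rfl)
      (fun _ => le_rfl)]
    have e : t^2 * (χ/5) = ∫ x in Ioo (0:ℝ) 1, x^4 * (t^2 * χ) := by
      rw [integral_mul_const, integral_pow_four zero_le_one]; ring
    rw [e]
    have hk : ∀ x > 0, kop α (fun _ => t) x = kerInt α x 1 * t := by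
      intro x hx
      rw [kop, integral_mul_const, kerInt_eq h0 h1 hx zero_le_one,
        intervalIntegral.integral_of_le zero_le_one, integral_Ioc_eq_integral_Ioo]
    have hmeas : AEStronglyMeasurable (fun x : ℝ => x^4 * kop α (fun _ => t) x * t)
        (volume.restrict (Ioo 0 1)) := by
      have : StronglyMeasurable (kop α (fun _ => t)) :=
        ((measurable_ker α).mul_const t).stronglyMeasurable.integral_prod_right'
      exact ((by fun_prop : Measurable fun x : ℝ => x^4).mul
        this.measurable).mul_const t |>.aestronglyMeasurable
    refine setIntegral_mono_on ?_ ?_ measurableSet_Ioo fun x hx => ?_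
    · exact integrableOn_pow_mul (M := |t^2*χ|) measurable_const fun _ => le_rfl
    · refine (integrable_const (2/3*(1+2*α) * (1 / (2 - 2*α)) * t^2)).mono' hmeas ?_
      filter_upwards [ae_restrict_mem measurableSet_Ioo] with x hx
      have h2 := kerInt_nonneg h0 h1 hx.1 zero_le_one
      have h3 := kerInt_le h0 h1 hx.1 zero_le_one
      rw [Real.one_rpow] at h3
      rw [hk x hx.1, Real.norm_of_nonneg
        (mul_nonneg (mul_nonneg (by positivity) (mul_nonneg h2 ht.1.le)) ht.1.le)]
      have h4 : x^4 * kerInt α x 1 ≤ 2/3*(1+2*α) * (1 / (2 - 2*α)) :=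
        (mul_le_of_le_one_left h2 (pow_le_one₀ hx.1.le hx.2.le)).trans h3
      have := mul_le_mul_of_nonneg_right h4 (sq_nonneg t)
      linarith
    · rw [hk x hx.1]
      have := kerInt_antitoneOn h0 h1 zero_le_one hx.1 (zero_lt_one (α := ℝ)) hx.2.le
      have h5 := mul_le_mul_of_nonneg_left this (show 0 ≤ x^4 * t^2 by positivity)
      simp only at h5
      linarith
  rw [energy, hm]
  have hN : 3 / (2*χ) / 2 * (t^2 * (χ/5)) = 3/20 * t^2 := by field_simp; ring
  have : 3 / (2*χ) / 2 * (t^2 * (χ/5)) ≤ 3 / (2*χ) / 2 * form α (fun _ => t) (fun _ => t) :=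
    mul_le_mul_of_nonneg_left hf (by positivity)
  have ht2 : 0 < t^2 := pow_pos ht.1 2
  have ht3 : t^2 ≤ 1 := pow_le_one₀ ht.1.le ht.2
  nlinarith

lemma nonpos_of_polynomial_bound {a b c d : ℝ}
    (h : ∀ t ∈ Ioc (0:ℝ) 1, t * (a + t * (b + c * t + d * t^2)) ≤ 0) : a ≤ 0 := by
  have hc : Continuous fun t : ℝ => a + t * (b + c * t + d * t^2) := by fun_prop
  have ht := (hc.tendsto 0).mono_left (nhdsWithin_le_nhds (s := Ioi 0))
  simp only [zero_mul, add_zero] at ht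
  refine le_of_tendsto ht ?_
  filter_upwards [Ioc_mem_nhdsGT (zero_lt_one (α := ℝ))] with t ht
  exact nonpos_of_mul_nonpos_right (h t ht) ht.1

lemma kop_congr_ae {q r : ℝ → ℝ} (h : q =ᵐ[volume.restrict (Ioo 0 1)] r) (x : ℝ) :
    kop α q x = kop α r x :=
  integral_congr_ae (h.mono fun y hy => by simp only [hy])

/-- Existence of a positive antitone eigenfunction of `kop`. -/
lemma exists_eigenfunction (h0 : 0 < α) (h1 : α < 1) :
    ∃ (M lam : ℝ) (q : ℝ → ℝ), q ∈ antitoneClass M ∧ (∀ x > 0, kop α q x = lam * q x) ∧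
      2/3 * kerInt α 1 1 ≤ lam ∧ ∃ y ∈ Ioo (0:ℝ) 1, 0 < q y := by
  have hχ := kerInt_one_one_pos h0 h1
  set N := 3 / (2 * kerInt α 1 1) with hN
  have hN0 : 0 < N := by positivity
  obtain ⟨M, hM, hinv⟩ := exists_invariant_bound h0 h1 hN0
  obtain ⟨q, hq, hmax⟩ := exists_energy_max h0 h1 N hM.le
  have hqm := hq.1.measurable
  have hqM := abs_le_of_mem_antitoneClass hq
  have hpos : 0 < energy α N q := by
    refine (energy_const_pos h0 h1 (t := min M 1) ⟨by positivity, min_le_right _ _⟩).trans_le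
      (hmax _ ⟨fun _ _ _ => le_rfl, fun _ => ⟨by positivity, min_le_left _ _⟩⟩)
  set n := mass q with hn
  have hn0 : 0 ≤ n := mass_nonneg q
  set r : ℝ → ℝ := fun x => if x ≤ 0 then M else N * kop α q x / (1 + n) with hr
  have hrpos : ∀ x > 0, r x = N * kop α q x / (1 + n) := fun x hx => if_neg (not_le.2 hx)
  have hrM : ∀ x, r x ∈ Icc 0 M := by
    intro x
    rcases le_or_gt x 0 with hx | hx
    · simp only [hr, if_pos hx]; exact ⟨hM.le, le_rfl⟩
    · rw [hrpos x hx]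
      exact ⟨div_nonneg (mul_nonneg hN0.le (kop_nonneg h0 h1 hq.2 hx)) (by positivity),
        hinv q hq x hx⟩
  have hrclass : r ∈ antitoneClass M := by
    refine ⟨fun x z hxz => ?_, hrM⟩
    rcases le_or_gt x 0 with hx | hx
    · have : r x = M := if_pos hx
      rw [this]; exact (hrM z).2
    · rw [hrpos x hx, hrpos z (hx.trans_le hxz)]
      have := kop_antitoneOn h0 h1 hq.1 hq.2 hx (hx.trans_le hxz) hxz
      gcongr
  have hrm := hrclass.1.measurable
  set v : ℝ → ℝ := fun x => r x - q x with hv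
  have hvm : Measurable v := hrm.sub hqm
  have hvM : ∀ y, |v y| ≤ M := fun y => by
    rw [hv, abs_le]
    constructor <;> linarith [(hrM y).1, (hrM y).2, (hq.2 y).1, (hq.2 y).2]
  set b := ∫ x in Ioo (0:ℝ) 1, x^4 * (q x * v x) with hb
  have hfirst : N * form α q v - (1 + n) * b = (1 + n) * mass v := by
    have i1 : IntegrableOn (fun x : ℝ => x^4 * (r x * v x)) (Ioo 0 1) :=
      integrableOn_pow_mul (M := M*M) (hrm.mul hvm) fun y => by
        rw [abs_mul]
        exact mul_le_mul (abs_le_of_mem_antitoneClass hrclass y) (hvM y) (abs_nonneg _) hM.le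
    have i2 : IntegrableOn (fun x : ℝ => x^4 * (q x * v x)) (Ioo 0 1) :=
      integrableOn_pow_mul (M := M*M) (hqm.mul hvm) fun y => by
        rw [abs_mul]; exact mul_le_mul (hqM y) (hvM y) (abs_nonneg _) hM.le
    have e1 : N * form α q v = (1 + n) * ∫ x in Ioo (0:ℝ) 1, x^4 * (r x * v x) := by
      rw [form_eq_kop h0 h1 hqm hvm hqM hvM, ← integral_const_mul, ← integral_const_mul]
      refine setIntegral_congr_fun measurableSet_Ioo fun x hx => ?_
      simp only [hrpos x hx.1]
      field_simp
    rw [e1, hb, ← mul_sub, ← integral_sub i1 i2, mass]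
    congr 2; funext x; simp only [hv]; ring
  have hmv : mass v = 0 := by
    have hle : (1 + n) * mass v ≤ 0 := by
      refine nonpos_of_polynomial_bound (b := N/2 * form α v v - mass v/2 - b^2 - n * mass v / 2)
        (c := -(b * mass v)) (d := -(mass v^2/4)) fun t ht => ?_
      have hmem : (fun x => q x + t * v x) ∈ antitoneClass M := by
        have e : (fun x => q x + t * v x) = fun x => (1 - t) * q x + t * r x := by
          funext x; simp only [hv]; ring
        rw [e]
        have ht1 : 0 ≤ 1 - t := by linarith [ht.2]
        refine ⟨fun x z hxz => ?_, fun y => ⟨?_, ?_⟩⟩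
        · exact add_le_add (mul_le_mul_of_nonneg_left (hq.1 hxz) ht1)
            (mul_le_mul_of_nonneg_left (hrclass.1 hxz) ht.1.le)
        · exact add_nonneg (mul_nonneg ht1 (hq.2 y).1) (mul_nonneg ht.1.le (hrM y).1)
        · nlinarith [mul_le_mul_of_nonneg_left (hq.2 y).2 ht1,
            mul_le_mul_of_nonneg_left (hrM y).2 ht.1.le]
      have h := hmax _ hmem
      rw [energy, energy, mass_add q v hqm hvm hqM hvM, form_add h0 h1 q v hqm hvm hqM hvM,
        ← hb, ← hn] at h
      rw [← hfirst]
      linarith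
    exact le_antisymm (nonpos_of_mul_nonpos_right hle (by positivity)) (mass_nonneg v)
  have hae : q =ᵐ[volume.restrict (Ioo 0 1)] r := by
    have h := (setIntegral_eq_zero_iff_of_nonneg_ae (Eventually.of_forall fun x =>
      (by positivity : 0 ≤ x^4 * v x ^ 2)) (integrableOn_mass hvm hvM)).1 hmv
    filter_upwards [h, ae_restrict_mem measurableSet_Ioo] with x hx hx1
    have hx4 : x^4 ≠ 0 := (pow_pos hx1.1 4).ne'
    have : v x ^ 2 = 0 := (mul_eq_zero.1 hx).resolve_left hx4
    have : v x = 0 := by simpa using this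
    simp only [hv] at this
    linarith
  refine ⟨M, (1 + n) / N, r, hrclass, fun x hx => ?_, ?_, ?_⟩
  · rw [← kop_congr_ae hae x, hrpos x hx]
    field_simp
  · rw [le_div_iff₀ hN0, hN]
    have : 2/3 * kerInt α 1 1 * (3 / (2 * kerInt α 1 1)) = 1 := by field_simp
    linarith
  · by_contra hcon
    push Not at hcon
    have hq0 : ∀ᵐ x ∂(volume.restrict (Ioo (0:ℝ) 1)), q x = 0 := by
      filter_upwards [hae, ae_restrict_mem measurableSet_Ioo] with x hx hx1
      rw [hx]; exact le_antisymm (hcon x hx1) (hrM x).1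
    have m0 : mass q = 0 := by
      rw [mass]; exact integral_eq_zero_of_ae (hq0.mono fun x hx => by simp [hx])
    have f0 : form α q q = 0 := by
      rw [form_eq_kop h0 h1 hqm hqm hqM hqM]
      exact integral_eq_zero_of_ae (hq0.mono fun x hx => by simp [hx])
    rw [energy, m0, f0] at hpos
    norm_num at hpos

end variational

section cumulative

variable {q : ℝ → ℝ}

/-- The cumulative integral `∫₀ˣ 2 y q(y) dy`. -/
def cumul (q : ℝ → ℝ) (x : ℝ) : ℝ := ∫ y in (0:ℝ)..x, 2*y*q y

lemma intervalIntegrable_two_mul (hq : Antitone q) (a b : ℝ) :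
    IntervalIntegrable (fun y => 2*y*q y) volume a b :=
  hq.intervalIntegrable.continuousOn_mul (by fun_prop)

lemma cumul_sub (hq : Antitone q) (a b : ℝ) :
    cumul q b - cumul q a = ∫ y in a..b, 2*y*q y :=
  intervalIntegral.integral_interval_sub_left (intervalIntegrable_two_mul hq _ _)
    (intervalIntegrable_two_mul hq _ _)

lemma integral_two_mul_mul_const (a b c : ℝ) : ∫ y in a..b, 2*y*c = c * (b^2 - a^2) := by
  rw [intervalIntegral.integral_mul_const, intervalIntegral.integral_const_mul, integral_id]
  ring

lemma le_cumul_sub (hq : Antitone q) {a b c : ℝ} (ha : 0 ≤ a) (hab : a ≤ b)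
    (hc : ∀ y ∈ Ioo a b, c ≤ q y) : c * (b^2 - a^2) ≤ cumul q b - cumul q a := by
  rw [cumul_sub hq, ← integral_two_mul_mul_const]
  refine intervalIntegral.integral_mono_on_of_le_Ioo hab
    (Continuous.intervalIntegrable (by fun_prop) _ _) (intervalIntegrable_two_mul hq _ _)
    fun y hy => ?_
  have : 0 ≤ 2*y := by linarith [hy.1]
  exact mul_le_mul_of_nonneg_left (hc y hy) this

lemma cumul_sub_le (hq : Antitone q) {a b c : ℝ} (ha : 0 ≤ a) (hab : a ≤ b)
    (hc : ∀ y ∈ Ioo a b, q y ≤ c) : cumul q b - cumul q a ≤ c * (b^2 - a^2) := by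
  rw [cumul_sub hq, ← integral_two_mul_mul_const]
  refine intervalIntegral.integral_mono_on_of_le_Ioo hab (intervalIntegrable_two_mul hq _ _)
    (Continuous.intervalIntegrable (by fun_prop) _ _) fun y hy => ?_
  have : 0 ≤ 2*y := by linarith [hy.1]
  exact mul_le_mul_of_nonneg_left (hc y hy) this

lemma cumul_zero (q : ℝ → ℝ) : cumul q 0 = 0 := intervalIntegral.integral_same

lemma continuous_cumul (hq : Antitone q) : Continuous (cumul q) :=
  intervalIntegral.continuous_primitive (intervalIntegrable_two_mul hq) 0

lemma cumul_mono (hq : Antitone q) (h : ∀ y, 0 ≤ q y) {a b : ℝ} (ha : 0 ≤ a) (hab : a ≤ b) :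
    cumul q a ≤ cumul q b := by
  have := le_cumul_sub hq ha hab (c := 0) fun y _ => h y
  linarith

/-- The even function with `f(0) = 1` and `f' = -2 x q(x)` on the positive axis. -/
def profile (q : ℝ → ℝ) (x : ℝ) : ℝ := 1 - cumul q |x|

lemma convexOn_profile_sqrt (hq : Antitone q) :
    ConvexOn ℝ (Ici 0) fun u => profile q (Real.sqrt u) := by
  refine convexOn_of_slope_mono_adjacent (convex_Ici 0) fun {x y z} hx hz hxy hyz => ?_
  have hy0 : 0 ≤ y := le_trans hx hxy.le
  have e : ∀ u, profile q (Real.sqrt u) = 1 - cumul q (Real.sqrt u) := fun u => by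
    rw [profile, abs_of_nonneg (Real.sqrt_nonneg u)]
  have h1 := le_cumul_sub hq (Real.sqrt_nonneg x) (Real.sqrt_le_sqrt hxy.le)
    (c := q (Real.sqrt y)) fun w hw => hq hw.2.le
  have h2 := cumul_sub_le hq (Real.sqrt_nonneg y) (Real.sqrt_le_sqrt hyz.le)
    (c := q (Real.sqrt y)) fun w hw => hq hw.1.le
  rw [Real.sq_sqrt hx, Real.sq_sqrt hy0] at h1
  rw [Real.sq_sqrt hz, Real.sq_sqrt hy0] at h2
  simp only [e]
  calc _ ≤ -q (Real.sqrt y) := by rw [div_le_iff₀ (by linarith)]; linarith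
    _ ≤ _ := by rw [le_div_iff₀ (by linarith)]; linarith

lemma hasDerivWithinAt_profile (hq : Antitone q) {x : ℝ} (hx : 0 < x) :
    HasDerivWithinAt (profile q) (-(2*x*Function.leftLim q x)) (Iio x) x := by
  have ht : Tendsto (fun y => 2*y*q y) (nhdsWithin x (Iio x))
      (nhds (2*x*Function.leftLim q x)) :=
    (tendsto_nhdsWithin_of_tendsto_nhds (Continuous.tendsto (by fun_prop) x)).mul
      (hq.tendsto_leftLim x)
  have h : HasDerivWithinAt (cumul q) (2*x*Function.leftLim q x) (Iio x) x := by
    refine (intervalIntegral.integral_hasDerivWithinAt_of_tendsto_ae_right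
      (intervalIntegrable_two_mul hq 0 x) (s := Iic x) (t := Iic x) ?_ ?_).mono Iio_subset_Iic_self
    · exact ((by fun_prop : Measurable fun y : ℝ => 2*y).mul
        hq.measurable).stronglyMeasurable.stronglyMeasurableAtFilter
    · have e : nhdsWithin x (Iic x) ⊓ ae volume ≤ nhdsWithin x (Iio x) := by
        refine le_inf (inf_le_left.trans nhdsWithin_le_nhds) (le_principal_iff.2 ?_)
        filter_upwards [inter_mem_inf (self_mem_nhdsWithin (s := Iic x) (a := x))
          (compl_mem_ae_iff.2 (measure_singleton (μ := volume) x))] with y hy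
        exact lt_of_le_of_ne hy.1 hy.2
      exact ht.mono_left e
  refine (h.const_sub 1).congr_of_eventuallyEq ?_ ?_
  · filter_upwards [nhdsWithin_le_nhds (Ioi_mem_nhds hx)] with y hy
    rw [profile, abs_of_pos hy]
  · rw [profile, abs_of_pos hx]

end cumulative

/-- A compactly supported eigenfunction of the integral operator with kernel `ker`, normalised so
that the associated `profile` is a fixed point of `RV`. -/
structure NormalisedEigen (α L lam : ℝ) (q : ℝ → ℝ) : Prop where
  antitone : Antitone q
  nonneg : ∀ y, 0 ≤ q y
  bdd : ∃ M, ∀ y, q y ≤ M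
  pos : 0 < L
  lam_pos : 0 < lam
  eq_zero : ∀ y ≥ L, q y = 0
  eigen : ∀ x ∈ Ioo 0 L, (∫ y in Ioo 0 L, ker α x y * q y) = lam * q x
  bound : ∀ x > 0, (∫ y in Ioo 0 L, ker α x y * q y) ≤ lam
  total : cumul q L = 1
  moment : 2/3*(1+2*α) * (∫ y in Ioo 0 L, q y * y ^ (1 - 2*α)) = lam
  le_lam : 2/3*kerInt α 1 1 * L ^ (2 - 2*α) ≤ lam

namespace NormalisedEigen

variable {α L lam x : ℝ} {q : ℝ → ℝ}

lemma integrableOn_mul (h : NormalisedEigen α L lam q) {D : ℝ → ℝ} {s : Set ℝ}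
    (hD : IntegrableOn D s) : IntegrableOn (fun y => D y * q y) s :=
  have ⟨_, hM⟩ := h.bdd
  integrableOn_mul_antitone hD h.antitone fun y => ⟨h.nonneg y, hM y⟩

lemma le_one (h : NormalisedEigen α L lam q) {y : ℝ} (hy : 0 < y) : q y ≤ 1 := by
  rcases lt_or_ge y L with hL | hL
  · have h1 := h.bound y hy
    rw [h.eigen y ⟨hy, hL⟩] at h1
    exact le_of_mul_le_mul_left (by linarith) h.lam_pos
  · rw [h.eq_zero y hL]; exact zero_le_one

lemma cumul_eq_one (h : NormalisedEigen α L lam q) (hx : L ≤ x) : cumul q x = 1 := by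
  have h1 := cumul_mono h.antitone h.nonneg h.pos.le hx
  have h2 := cumul_sub_le h.antitone h.pos.le hx (c := 0) fun y hy => (h.eq_zero y hy.1.le).le
  have := h.total
  linarith

lemma cumul_le_one (h : NormalisedEigen α L lam q) (hx : 0 ≤ x) : cumul q x ≤ 1 := by
  rw [← h.cumul_eq_one (le_max_right x L)]
  exact cumul_mono h.antitone h.nonneg hx (le_max_left _ _)

lemma cumul_le_sq (h : NormalisedEigen α L lam q) (hx : 0 ≤ x) : cumul q x ≤ x^2 := by
  have := cumul_sub_le h.antitone le_rfl hx (c := 1) fun y hy => h.le_one hy.1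
  rw [cumul_zero] at this
  linarith

lemma one_le (h : NormalisedEigen α L lam q) : 1 ≤ L := by
  have h1 := h.cumul_le_sq h.pos.le
  rw [h.total] at h1
  nlinarith [h.pos]

lemma le_apply_half (h : NormalisedEigen α L lam q) : 3/4 ≤ q (1/2) * L^2 := by
  have h1 := h.cumul_le_sq (x := 1/2) (by norm_num)
  have h2 := cumul_sub_le h.antitone (a := 1/2) (b := L) (c := q (1/2)) (by norm_num)
    (by linarith [h.one_le]) fun y hy => h.antitone hy.1.le
  rw [h.total] at h2
  nlinarith [h.nonneg (1/2)]

lemma moment_le (h : NormalisedEigen α L lam q) (h0 : 0 < α) (h1 : α < 1) :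
    ∫ y in Ioo 0 L, q y * y ^ (1 - 2*α) ≤ 1 / (2 - 2*α) := by
  have hr : ∀ a b : ℝ, IntervalIntegrable (fun y : ℝ => y ^ (1 - 2*α)) volume a b :=
    fun a b => intervalIntegral.intervalIntegrable_rpow' (by linarith)
  have hsub : IntervalIntegrable (fun y : ℝ => y ^ (1 - 2*α) - y) volume 0 1 :=
    (hr _ _).sub intervalIntegral.intervalIntegrable_id
  have hi : ∀ a b : ℝ, IntervalIntegrable (fun y : ℝ => q y * y ^ (1 - 2*α)) volume a b :=
    fun a b => by
      simp only [mul_comm (q _)]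
      exact ⟨h.integrableOn_mul (hr a b).1, h.integrableOn_mul (hr a b).2⟩
  have hq : ∀ a b, IntervalIntegrable (fun y => 2*y*q y) volume a b :=
    intervalIntegrable_two_mul h.antitone
  have a1 : ∫ y in (0:ℝ)..1, q y * y ^ (1 - 2*α) ≤
      ∫ y in (0:ℝ)..1, (y ^ (1 - 2*α) - y + 1/2 * (2*y*q y)) := by
    refine intervalIntegral.integral_mono_on_of_le_Ioo zero_le_one (hi _ _)
      (hsub.add ((hq _ _).const_mul _)) fun y hy => ?_
    have e : y ≤ y ^ (1 - 2*α) := by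
      conv_lhs => rw [← Real.rpow_one y]
      exact Real.rpow_le_rpow_of_exponent_ge hy.1 hy.2.le (by linarith)
    nlinarith [h.le_one hy.1]
  have a2 : ∫ y in (1:ℝ)..L, q y * y ^ (1 - 2*α) ≤ ∫ y in (1:ℝ)..L, 1/2 * (2*y*q y) := by
    refine intervalIntegral.integral_mono_on_of_le_Ioo h.one_le (hi _ _)
      ((hq _ _).const_mul _) fun y hy => ?_
    have e : y ^ (1 - 2*α) ≤ y := by
      conv_rhs => rw [← Real.rpow_one y]
      exact Real.rpow_le_rpow_of_exponent_le hy.1.le (by linarith)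
    nlinarith [h.nonneg y]
  rw [intervalIntegral.integral_add hsub ((hq _ _).const_mul _),
    intervalIntegral.integral_sub (hr _ _) intervalIntegral.intervalIntegrable_id, integral_id,
    integral_rpow (Or.inl (by linarith)), intervalIntegral.integral_const_mul] at a1
  rw [intervalIntegral.integral_const_mul, ← cumul_sub h.antitone, h.total] at a2
  rw [← integral_Ioc_eq_integral_Ioo, ← intervalIntegral.integral_of_le h.pos.le,
    ← intervalIntegral.integral_add_adjacent_intervals (hi 0 1) (hi 1 L)]
  rw [Real.one_rpow, Real.zero_rpow (by linarith), ← cumul,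
    show 1 - 2*α + 1 = 2 - 2*α by ring] at a1
  linarith

lemma etaC_le (h : NormalisedEigen α L lam q) (h0 : 0 < α) (h1 : α < 1) :
    etaC α ≤ q (1/2) := by
  set B := (3 - 2*α) * (5 - 2*α) with hB
  have hB3 : 3 ≤ B := by nlinarith
  have hp : 0 < 1 - α := by linarith
  have hL2 : 4 * L^2 ≤ B ^ (1 / (1 - α)) := by
    have e1 : (4 * L^2) ^ (1 - α) = 2 ^ (2 - 2*α) * L ^ (2 - 2*α) := by
      rw [show 4 * L^2 = (2*L) ^ (2:ℝ) by norm_cast; ring, ← Real.rpow_mul (by linarith [h.pos]),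
        Real.mul_rpow zero_le_two h.pos.le, show 2 * (1 - α) = 2 - 2*α by ring]
    have e2 : (4 * L^2) ^ (1 - α) ≤ B := by
      rw [e1]
      have m := h.moment_le h0 h1
      have l := h.le_lam
      rw [← h.moment, kerInt_one_one h1] at l
      have m' := mul_le_mul_of_nonneg_left m (show 0 ≤ 2/3*(1+2*α) by linarith)
      have l' := l.trans m'
      have h3 : 0 < 3 - 2*α := by linarith
      have h5 : 0 < 5 - 2*α := by linarith
      have h2 : 0 < 2 - 2*α := by linarith
      have hc : 0 < 2/3*(1+2*α) / ((2 - 2*α)*B) := by positivity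
      refine le_of_mul_le_mul_left ?_ hc
      refine le_trans (le_of_eq ?_) (l'.trans (le_of_eq ?_))
      · rw [hB]; field_simp
      · field_simp
    calc 4 * L^2 = ((4 * L^2) ^ (1 - α)) ^ (1 / (1 - α)) := by
          rw [← Real.rpow_mul (by positivity), mul_one_div_cancel hp.ne', Real.rpow_one]
      _ ≤ _ := Real.rpow_le_rpow (by positivity) e2 (by positivity)
  set m := min α (1 - α)
  have hm : 0 < m := lt_min h0 hp
  have h4 : 1 ≤ (4:ℝ) ^ α := Real.one_le_rpow (by norm_num) h0.le
  set θ := 3 / (2*(3 - 2*α)*(5 - 2*α)*(1 + (4:ℝ) ^ α)) with hθ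
  have eθ : θ = 3 / (2*B*(1 + (4:ℝ) ^ α)) := by rw [hθ, hB]; congr 1; ring
  have hθB : θ ≤ B⁻¹ := by
    rw [eθ, div_le_iff₀ (by positivity)]
    field_simp
    linarith
  have hθ0 : 0 < θ := by rw [eθ]; positivity
  have hB0 : 0 < B := by linarith
  have hθ1 : θ ≤ 1 := hθB.trans (inv_le_one_of_one_le₀ (by linarith))
  have k1 : θ ^ (1/m) ≤ (B ^ (1 / (1 - α)))⁻¹ := by
    rw [← Real.inv_rpow hB0.le]
    exact (Real.rpow_le_rpow_of_exponent_ge hθ0 hθ1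
      (one_div_le_one_div_of_le hm (min_le_right _ _))).trans
      (Real.rpow_le_rpow hθ0.le hθB (by positivity))
  have hL0 : 0 < L^2 := pow_pos h.pos 2
  have k2 : (B ^ (1 / (1 - α)))⁻¹ ≤ (4 * L^2)⁻¹ := inv_anti₀ (by positivity) hL2
  have k3 : 3/4 / L^2 ≤ q (1/2) := by
    rw [div_le_iff₀ hL0]; exact h.le_apply_half
  rw [etaC]
  have k4 : 2 * (4 * L^2)⁻¹ ≤ 3/4 / L^2 := by
    rw [mul_inv, div_eq_mul_inv]
    nlinarith [inv_pos.2 hL0]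
  linarith

lemma profile_mem (h : NormalisedEigen α L lam q) (h0 : 0 < α) (h1 : α < 1) :
    V1 α (profile q) := by
  have hnn : ∀ x, 0 ≤ profile q x := fun x => by
    rw [profile]; linarith [h.cumul_le_one (abs_nonneg x)]
  refine ⟨?_, fun x => by rw [profile, profile, abs_neg], ⟨1, fun x => ?_⟩, ?_, fun x _ => hnn x,
    ?_, convexOn_profile_sqrt h.antitone, fun x => max_le (hnn x) ?_,
    _, hasDerivWithinAt_profile h.antitone (by norm_num), ?_⟩
  · exact continuous_const.sub ((continuous_cumul h.antitone).comp continuous_abs)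
  · have hρ : rho α x ≤ 1 :=
      Real.rpow_le_one_of_one_le_of_nonpos (by linarith [abs_nonneg x]) (by linarith)
    have hf : |profile q x| ≤ 1 := by
      rw [abs_of_nonneg (hnn x), profile]
      have := cumul_mono h.antitone h.nonneg le_rfl (abs_nonneg x)
      rw [cumul_zero] at this
      linarith
    exact mul_le_one₀ hρ (abs_nonneg _) hf
  · rw [profile, abs_zero, cumul_zero, sub_zero]
  · intro x hx y hy hxy
    rw [profile, profile, abs_of_nonneg (a := x) hx, abs_of_nonneg (a := y) hy]
    linarith [cumul_mono h.antitone h.nonneg hx hxy]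
  · rw [profile]
    have := h.cumul_le_sq (abs_nonneg x)
    rw [sq_abs] at this
    linarith
  · have e1 := h.etaC_le h0 h1
    have e2 := h.antitone.le_leftLim (le_refl (1/2 : ℝ))
    linarith

end NormalisedEigen

lemma integral_triangle {F : ℝ → ℝ → ℝ} {L : ℝ} (hF : Integrable (Function.uncurry F)
      ((volume.restrict (Ioo 0 L)).prod (volume.restrict (Ioo 0 L)))) :
    ∫ ξ in Ioo 0 L, ∫ R in Ioo ξ L, F ξ R = ∫ R in Ioo 0 L, ∫ ξ in Ioo 0 R, F ξ R := by
  have hs : MeasurableSet {p : ℝ × ℝ | p.1 < p.2} := measurableSet_lt measurable_fst measurable_snd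
  have hG := integral_integral_swap
    (f := fun ξ R => Set.indicator {p : ℝ × ℝ | p.1 < p.2} (Function.uncurry F) (ξ, R))
    (hF.indicator hs)
  have e1 : ∀ ξ R, Set.indicator {p : ℝ × ℝ | p.1 < p.2} (Function.uncurry F) (ξ, R) =
      (Ioi ξ).indicator (F ξ) R := fun ξ R => rfl
  have e2 : ∀ ξ R, Set.indicator {p : ℝ × ℝ | p.1 < p.2} (Function.uncurry F) (ξ, R) =
      (Iio R).indicator (fun ξ => F ξ R) ξ := fun ξ R => rfl
  have l : ∫ ξ in Ioo 0 L, ∫ R in Ioo ξ L, F ξ R =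
      ∫ ξ in Ioo 0 L, ∫ R in Ioo 0 L, (Ioi ξ).indicator (F ξ) R := by
    refine setIntegral_congr_fun measurableSet_Ioo fun ξ hξ => ?_
    simp only [setIntegral_indicator measurableSet_Ioi]
    rw [Ioo_inter_Ioi, max_eq_right hξ.1.le]
  have r : ∫ R in Ioo 0 L, ∫ ξ in Ioo 0 R, F ξ R =
      ∫ R in Ioo 0 L, ∫ ξ in Ioo 0 L, (Iio R).indicator (fun ξ => F ξ R) ξ := by
    refine setIntegral_congr_fun measurableSet_Ioo fun R hR => ?_
    simp only [setIntegral_indicator measurableSet_Iio]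
    rw [Ioo_inter_Iio, min_eq_right hR.2.le]
  rw [l, r]
  simp only [e1] at hG
  rw [hG]
  rfl

lemma TV_eq (α : ℝ) (f : ℝ → ℝ) {x : ℝ} (hx : x ≠ 0) :
    TV α f x = C1 α * ∫ ξ in Ioi (0:ℝ),
      f ξ * (J0 α |x| ξ * ξ / |x| - 2 * ξ ^ (1 - 2*α)) := by
  have hx0 : 0 < |x| := abs_pos.2 hx
  rw [TV, if_neg hx]
  split_ifs with hα
  · congr 1
    refine setIntegral_congr_ae measurableSet_Ioi ?_
    filter_upwards [compl_mem_ae_iff.2 (measure_singleton (μ := volume) |x|)] with ξ hξ hξ0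
    have h1 : |x| - ξ ≠ 0 := fun h => hξ (by simp; linarith)
    have h2 : |x| + ξ ≠ 0 := (add_pos hx0 hξ0).ne'
    rw [J0, prim0, prim0, if_pos hα, if_pos hα, abs_of_pos (add_pos hx0 hξ0),
      Real.log_div h2 (abs_ne_zero.2 h1), hα]
    norm_num
    left; ring
  · have hα' : 1 - 2*α ≠ 0 := fun h => hα (by linarith)
    rw [div_mul_eq_mul_div, mul_div_assoc, ← integral_div]
    congr 1
    refine setIntegral_congr_fun measurableSet_Ioi fun ξ hξ => ?_
    simp only [J0, prim0, if_neg hα, abs_of_pos (add_pos hx0 hξ)]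
    field_simp

namespace NormalisedEigen

variable {α L lam x : ℝ} {q : ℝ → ℝ}

lemma integral_one_sub_profile (h : NormalisedEigen α L lam q) (h0 : 0 < α) (h1 : α < 1) :
    ∫ ξ in Ioi (0:ℝ), (1 - profile q ξ) * ξ ^ (-1 - 2*α) =
      (∫ y in Ioo 0 L, q y * y ^ (1 - 2*α)) / α := by
  set G : ℝ → ℝ → ℝ := fun ξ y => Set.indicator {p : ℝ × ℝ | p.2 < p.1}
    (fun p => p.1 ^ (-1 - 2*α) * (2*p.2*q p.2)) (ξ, y) with hG
  have g1 : ∀ ξ y, G ξ y = (Iio ξ).indicator (fun y => ξ ^ (-1 - 2*α) * (2*y*q y)) y :=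
    fun ξ y => rfl
  have g2 : ∀ ξ y, G ξ y = (Ioi y).indicator (fun ξ => ξ ^ (-1 - 2*α) * (2*y*q y)) ξ :=
    fun ξ y => rfl
  have left : ∀ ξ ∈ Ioi (0:ℝ), (1 - profile q ξ) * ξ ^ (-1 - 2*α) =
      ∫ y in Ioo 0 L, G ξ y := by
    intro ξ hξ
    simp only [g1]
    rw [setIntegral_indicator measurableSet_Iio, Ioo_inter_Iio, integral_const_mul,
      ← integral_Ioc_eq_integral_Ioo, ← intervalIntegral.integral_of_le (le_min h.pos.le hξ.le),
      ← cumul, profile, abs_of_pos hξ, sub_sub_cancel, mul_comm]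
    congr 1
    rcases le_total L ξ with hL | hL
    · rw [min_eq_left hL, h.total, h.cumul_eq_one hL]
    · rw [min_eq_right hL]
  have right : ∀ y ∈ Ioo 0 L, ∫ ξ in Ioi (0:ℝ), G ξ y = q y * y ^ (1 - 2*α) / α := by
    intro y hy
    simp only [g2]
    rw [setIntegral_indicator measurableSet_Ioi, Ioi_inter_Ioi, max_eq_right hy.1.le,
      integral_mul_const, integral_Ioi_rpow_of_lt (by linarith) hy.1,
      show 1 - 2*α = -(2*α) + 1 by ring, show -1 - 2*α + 1 = -(2*α) by ring,
      Real.rpow_add_one hy.1.ne']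
    generalize y ^ (-(2*α)) = w
    field_simp
  have hm : Measurable (Function.uncurry G) := by
    refine Measurable.indicator ?_ (measurableSet_lt measurable_snd measurable_fst)
    exact (measurable_fst.pow_const _).mul
      ((measurable_snd.const_mul 2).mul (h.antitone.measurable.comp measurable_snd))
  have hint : Integrable (Function.uncurry G)
      ((volume.restrict (Ioi 0)).prod (volume.restrict (Ioo 0 L))) := by
    rw [integrable_prod_iff' hm.aestronglyMeasurable]
    constructor
    · filter_upwards [ae_restrict_mem measurableSet_Ioo] with y hy
      simp only [Function.uncurry_apply_pair, g2]
      rw [integrable_indicator_iff measurableSet_Ioi, IntegrableOn,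
        Measure.restrict_restrict measurableSet_Ioi, Ioi_inter_Ioi, max_eq_left hy.1.le]
      exact (integrableOn_Ioi_rpow_of_lt (by linarith) hy.1).mul_const _
    · refine ((h.integrableOn_mul (integrableOn_rpow_Ioo h1 h.pos.le)).div_const α).congr ?_
      filter_upwards [ae_restrict_mem measurableSet_Ioo] with y hy
      rw [mul_comm, ← right y hy]
      refine setIntegral_congr_fun measurableSet_Ioi fun ξ hξ => ?_
      have hξ' : 0 < ξ := hξ
      have : 0 ≤ G ξ y := by
        refine Set.indicator_apply_nonneg fun _ => ?_
        have := h.nonneg y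
        have := hy.1
        positivity
      exact (Real.norm_of_nonneg this).symm
  rw [setIntegral_congr_fun measurableSet_Ioi left, integral_integral_swap hint,
    setIntegral_congr_fun measurableSet_Ioo right, integral_div]

lemma cV_profile (h : NormalisedEigen α L lam q) (h0 : 0 < α) (h1 : α < 1) :
    cV α (profile q) = C1 α * lam := by
  rw [cV, h.integral_one_sub_profile h0 h1, ← h.moment]
  field_simp

lemma integral_ker_mul_nonneg (h : NormalisedEigen α L lam q) (h0 : 0 < α) (h1 : α < 1)
    (hx : 0 < x) : 0 ≤ ∫ y in Ioo 0 L, ker α x y * q y :=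
  setIntegral_nonneg measurableSet_Ioo fun y hy =>
    mul_nonneg (ker_nonneg h0 h1 hx hy.1) (h.nonneg y)

lemma integrable_ker_mul (h : NormalisedEigen α L lam q) (h0 : 0 < α) (h1 : α < 1) (x : ℝ) :
    Integrable (fun p : ℝ × ℝ => 2*p.1*(ker α p.1 p.2 * q p.2))
      ((volume.restrict (Ioo 0 x)).prod (volume.restrict (Ioo 0 L))) := by
  have hm : Measurable fun p : ℝ × ℝ => 2*p.1*(ker α p.1 p.2 * q p.2) :=
    (measurable_fst.const_mul 2).mul
      ((measurable_ker α).mul (h.antitone.measurable.comp measurable_snd))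
  rw [integrable_prod_iff hm.aestronglyMeasurable]
  constructor
  · filter_upwards [ae_restrict_mem measurableSet_Ioo] with t ht
    exact (h.integrableOn_mul (integrableOn_ker h0 h1 ht.1 h.pos.le)).const_mul _
  · refine (integrable_const (2*x*lam)).mono' hm.aestronglyMeasurable.norm.integral_prod_right' ?_
    filter_upwards [ae_restrict_mem measurableSet_Ioo] with t ht
    have e : ∫ y in Ioo 0 L, ‖2*t*(ker α t y * q y)‖ =
        2*t*∫ y in Ioo 0 L, ker α t y * q y := by
      rw [← integral_const_mul]
      refine setIntegral_congr_fun measurableSet_Ioo fun y hy => ?_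
      have := ker_nonneg h0 h1 ht.1 hy.1
      have := h.nonneg y
      have := ht.1
      exact Real.norm_of_nonneg (by positivity)
    have hk := h.integral_ker_mul_nonneg h0 h1 ht.1
    have ht0 := ht.1
    rw [e, Real.norm_of_nonneg (by positivity)]
    exact mul_le_mul (by linarith [ht.2]) (h.bound t ht.1) hk (by linarith [ht.2])

/-- The integral defining `TV`, for a profile, in terms of the operator with kernel `ker`. -/
lemma integral_profile_mul (h : NormalisedEigen α L lam q) (h0 : 0 < α) (h1 : α < 1)
    (hx : 0 < x) :
    ∫ ξ in Ioi (0:ℝ), profile q ξ * (J0 α x ξ * ξ / x - 2 * ξ ^ (1 - 2*α)) =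
      -∫ t in Ioo 0 x, 2*t*(∫ y in Ioo 0 L, ker α t y * q y) := by
  set D : ℝ → ℝ := fun ξ => J0 α x ξ * ξ / x - 2 * ξ ^ (1 - 2*α) with hD
  have hDi : ∀ R ≥ 0, IntegrableOn D (Ioo 0 R) := fun R hR =>
    (((intervalIntegrable_iff_integrableOn_Ioc_of_le hR).1 (integral_J0 h1 hx hR).1).mono_set
      Ioo_subset_Ioc_self).sub ((integrableOn_rpow_Ioo h1 hR).const_mul 2)
  have hDe : ∀ R > 0, ∫ ξ in Ioo 0 R, D ξ = potInt α x R - R ^ (2 - 2*α) / (1 - α) := by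
    intro R hR
    have e := integral_J0 h1 hx hR.le
    have h1' : 1 - α ≠ 0 := by linarith
    rw [← integral_Ioc_eq_integral_Ioo, ← intervalIntegral.integral_of_le hR.le, hD,
      intervalIntegral.integral_sub e.1
        ((intervalIntegral.intervalIntegrable_rpow' (by linarith)).const_mul 2), e.2,
      intervalIntegral.integral_const_mul, integral_rpow (Or.inl (by linarith)),
      Real.zero_rpow (by linarith), show 1 - 2*α + 1 = 2 * (1 - α) by ring,
      show 2 - 2*α = 2 * (1 - α) by ring]
    field_simp
    ring
  have hqi : IntegrableOn (fun y => 2*y*q y) (Ioo 0 L) :=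
    ((intervalIntegrable_iff_integrableOn_Ioc_of_le h.pos.le).1
      (intervalIntegrable_two_mul h.antitone 0 L)).mono_set Ioo_subset_Ioc_self
  have s1 : ∫ ξ in Ioi (0:ℝ), profile q ξ * D ξ = ∫ ξ in Ioo 0 L, profile q ξ * D ξ := by
    refine setIntegral_eq_of_subset_of_forall_sdiff_eq_zero measurableSet_Ioi Ioo_subset_Ioi_self
      fun ξ hξ => ?_
    have : L ≤ ξ := not_lt.1 fun hl => hξ.2 ⟨hξ.1, hl⟩
    rw [profile, abs_of_pos hξ.1, h.cumul_eq_one this, sub_self, zero_mul]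
  have s2 : ∫ ξ in Ioo 0 L, profile q ξ * D ξ =
      ∫ ξ in Ioo 0 L, ∫ R in Ioo ξ L, D ξ * (2*R*q R) := by
    refine setIntegral_congr_fun measurableSet_Ioo fun ξ hξ => ?_
    simp only [integral_const_mul]
    rw [← integral_Ioc_eq_integral_Ioo, ← intervalIntegral.integral_of_le hξ.2.le,
      ← cumul_sub h.antitone, h.total, profile, abs_of_pos hξ.1, mul_comm]
  have s3 : ∫ R in Ioo 0 L, ∫ ξ in Ioo 0 R, D ξ * (2*R*q R) =
      -∫ R in Ioo 0 L, ∫ t in Ioo 0 x, 2*t*(ker α t R * q R) := by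
    rw [← integral_neg]
    refine setIntegral_congr_fun measurableSet_Ioo fun R hR => ?_
    have e := (integral_mul_ker_left h0 h1 hx.le hR.1).2 hx
    rw [intervalIntegral.integral_of_le hx.le, integral_Ioc_eq_integral_Ioo] at e
    simp only [← mul_assoc, integral_mul_const]
    rw [e, hDe R hR.1]
    ring
  rw [s1, s2, integral_triangle (F := fun ξ R => D ξ * (2*R*q R)) ((hDi L h.pos.le).mul_prod hqi),
    s3,
    ← integral_integral_swap (h.integrable_ker_mul h0 h1 x)]
  simp only [integral_const_mul]

lemma integral_eigen (h : NormalisedEigen α L lam q) (hx : 0 < x) (hxL : x ≤ L) :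
    ∫ t in Ioo 0 x, 2*t*(∫ y in Ioo 0 L, ker α t y * q y) = lam * cumul q x := by
  rw [cumul, intervalIntegral.integral_of_le hx.le, integral_Ioc_eq_integral_Ioo,
    ← integral_const_mul]
  refine setIntegral_congr_fun measurableSet_Ioo fun t ht => ?_
  simp only [h.eigen t ⟨ht.1, ht.2.trans_le hxL⟩]
  ring

lemma RV_profile (h : NormalisedEigen α L lam q) (h0 : 0 < α) (h1 : α < 1) (x : ℝ) :
    RV α (profile q) x = profile q x := by
  rcases eq_or_ne x 0 with rfl | hx
  · rw [RV, TV, if_pos rfl, profile, abs_zero, cumul_zero]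
    norm_num
  have hx0 := abs_pos.2 hx
  have hC : C1 α ≠ 0 := by
    rw [C1]
    have := Real.Gamma_pos_of_pos (show 0 < 1/2 + α by linarith)
    have := Real.Gamma_pos_of_pos (show 0 < 1 - α by linarith)
    positivity
  have hl := h.lam_pos
  rw [RV, TV_eq _ _ hx, h.cV_profile h0 h1, h.integral_profile_mul h0 h1 hx0,
    mul_div_mul_left _ _ hC]
  rcases le_total |x| L with hL | hL
  · rw [h.integral_eigen hx0 hL, neg_div, mul_div_cancel_left₀ _ hl.ne', profile,
      ← sub_eq_add_neg, max_eq_right (by linarith [h.cumul_le_one hx0.le])]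
  · rw [profile, h.cumul_eq_one hL, sub_self]
    refine max_eq_left ?_
    have hmono : ∫ t in Ioo 0 L, 2*t*(∫ y in Ioo 0 L, ker α t y * q y) ≤
        ∫ t in Ioo 0 |x|, 2*t*(∫ y in Ioo 0 L, ker α t y * q y) := by
      refine setIntegral_mono_set ?_ ?_ (Ioo_subset_Ioo_right hL).eventuallyLE
      · have := (h.integrable_ker_mul h0 h1 |x|).integral_prod_left
        simp only [integral_const_mul] at this
        exact this
      · filter_upwards [ae_restrict_mem measurableSet_Ioo] with t ht
        exact mul_nonneg (by linarith [ht.1]) (h.integral_ker_mul_nonneg h0 h1 ht.1)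
    rw [h.integral_eigen h.pos le_rfl, h.total, mul_one] at hmono
    rw [neg_div, ← sub_eq_add_neg, sub_nonpos, le_div_iff₀ hl]
    linarith

end NormalisedEigen

lemma integral_Ioo_comp_mul (g : ℝ → ℝ) {l : ℝ} (hl : 0 < l) :
    ∫ y in Ioo 0 l⁻¹, g (l*y) = l⁻¹ * ∫ y in Ioo 0 1, g y := by
  rw [← integral_Ioc_eq_integral_Ioo, ← integral_Ioc_eq_integral_Ioo,
    ← intervalIntegral.integral_of_le (inv_pos.2 hl).le,
    ← intervalIntegral.integral_of_le zero_le_one, intervalIntegral.integral_comp_mul_left _ hl.ne',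
    mul_zero, mul_inv_cancel₀ hl.ne', smul_eq_mul]

lemma exists_normalisedEigen {α : ℝ} (h0 : 0 < α) (h1 : α < 1) :
    ∃ L lam q, NormalisedEigen α L lam q := by
  obtain ⟨M, lam, q, ⟨hq, hM⟩, heig, hlam, y₀, hy₀, hqy₀⟩ := exists_eigenfunction h0 h1
  have hlam0 : 0 < lam := by linarith [kerInt_one_one_pos h0 h1]
  set m := 2/3*(1+2*α) * ∫ y in Ioo (0:ℝ) 1, q y * y ^ (1 - 2*α) with hm
  have hkop : ∀ x > 0, kop α q x ≤ m := fun x hx => kop_le h0 h1 hq hM hx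
  have hm0 : 0 < m := by
    have := hkop y₀ hy₀.1
    rw [heig y₀ hy₀.1] at this
    exact (mul_pos hlam0 hqy₀).trans_le this
  have htot : 0 < cumul q 1 := by
    have e1 := le_cumul_sub hq le_rfl hy₀.1.le (c := q y₀) fun y hy => hq hy.2.le
    have e2 := cumul_mono hq (fun y => (hM y).1) hy₀.1.le hy₀.2.le
    rw [cumul_zero] at e1
    nlinarith [mul_pos hqy₀ (pow_pos hy₀.1 2)]
  have hc : 0 < lam / m := div_pos hlam0 hm0
  set c := lam / m with hcdef
  have hl : 0 < Real.sqrt (c * cumul q 1) := Real.sqrt_pos.2 (mul_pos hc htot)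
  have hl2 : Real.sqrt (c * cumul q 1) ^ 2 = c * cumul q 1 := Real.sq_sqrt (mul_pos hc htot).le
  set l := Real.sqrt (c * cumul q 1)
  set L := l⁻¹ with hL
  have hL0 : 0 < L := inv_pos.2 hl
  have hlL : l * L = 1 := mul_inv_cancel₀ hl.ne'
  set r : ℝ → ℝ := fun y => if l*y < 1 then c * q (l*y) else 0 with hr
  have hpow : L * (L ^ (1 - 2*α)) = L ^ (2 - 2*α) := by
    rw [show 2 - 2*α = (1 - 2*α) + 1 by ring, Real.rpow_add_one hL0.ne', mul_comm]
  have hmem : ∀ y ∈ Ioo 0 L, l*y ∈ Ioo (0:ℝ) 1 ∧ r y = c * q (l*y) := by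
    intro y hy
    have : l*y < 1 := by rw [← hlL]; exact mul_lt_mul_of_pos_left hy.2 hl
    exact ⟨⟨mul_pos hl hy.1, this⟩, if_pos this⟩
  have hker : ∀ x > 0, ∫ y in Ioo 0 L, ker α x y * r y =
      L ^ (2 - 2*α) * (c * kop α q (l*x)) := by
    intro x hx
    rw [kop, ← hpow, ← mul_assoc, mul_assoc L, mul_assoc L, ← integral_const_mul,
      ← integral_Ioo_comp_mul _ hl]
    refine setIntegral_congr_fun measurableSet_Ioo fun y hy => ?_
    simp only [(hmem y hy).2]
    rw [ker_mul hl hx hy.1, hL, Real.inv_rpow hl.le]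
    have : l ^ (1 - 2*α) ≠ 0 := (Real.rpow_pos_of_pos hl _).ne'
    field_simp
  refine ⟨L, lam * L ^ (2 - 2*α), r, ?_, ?_, ⟨c*M, ?_⟩, hL0, by positivity, ?_, ?_, ?_, ?_, ?_, ?_⟩
  · intro x z hxz
    simp only [hr]
    have hlx : l*x ≤ l*z := mul_le_mul_of_nonneg_left hxz hl.le
    split_ifs with hz hx hx
    · exact mul_le_mul_of_nonneg_left (hq hlx) hc.le
    · exact absurd (hlx.trans_lt hz) hx
    · exact mul_nonneg hc.le (hM _).1
    · exact le_rfl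
  · intro y
    simp only [hr]
    split_ifs
    · exact mul_nonneg hc.le (hM _).1
    · exact le_rfl
  · intro y
    simp only [hr]
    split_ifs
    · exact mul_le_mul_of_nonneg_left (hM _).2 hc.le
    · exact mul_nonneg hc.le ((hM 0).1.trans (hM 0).2)
  · intro y hy
    refine if_neg (not_lt.2 ?_)
    rw [← hlL]; exact mul_le_mul_of_nonneg_left hy hl.le
  · intro x hx
    rw [hker x hx.1, heig _ (mul_pos hl hx.1), (hmem x hx).2]
    ring
  · intro x hx
    rw [hker x hx]
    have := mul_le_mul_of_nonneg_left (hkop (l*x) (mul_pos hl hx)) hc.le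
    rw [hcdef, div_mul_cancel₀ _ hm0.ne', ← hcdef] at this
    rw [mul_comm lam]
    exact mul_le_mul_of_nonneg_left this (by positivity)
  · have e : cumul r L = c * L^2 * cumul q 1 := by
      rw [cumul, cumul, intervalIntegral.integral_of_le hL0.le,
        intervalIntegral.integral_of_le zero_le_one, integral_Ioc_eq_integral_Ioo,
        integral_Ioc_eq_integral_Ioo, show c * L^2 = L * (L*c) by ring, mul_assoc,
        ← integral_const_mul, ← integral_Ioo_comp_mul _ hl]
      refine setIntegral_congr_fun measurableSet_Ioo fun y hy => ?_
      simp only [(hmem y hy).2]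
      linear_combination (-2 * y * c * q (l*y)) * hlL
    rw [e, show c * L^2 * cumul q 1 = L^2 * (c * cumul q 1) by ring, ← hl2, ← mul_pow,
      mul_comm, hlL, one_pow]
  · have e : ∫ y in Ioo 0 L, r y * y ^ (1 - 2*α) =
        L ^ (2 - 2*α) * (c * ∫ y in Ioo (0:ℝ) 1, q y * y ^ (1 - 2*α)) := by
      rw [← hpow, ← mul_assoc, mul_assoc L, mul_assoc L, ← integral_const_mul,
        ← integral_Ioo_comp_mul _ hl]
      refine setIntegral_congr_fun measurableSet_Ioo fun y hy => ?_
      simp only [(hmem y hy).2]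
      rw [Real.mul_rpow hl.le hy.1.le, hL, Real.inv_rpow hl.le]
      have : l ^ (1 - 2*α) ≠ 0 := (Real.rpow_pos_of_pos hl _).ne'
      field_simp
    have hcm : c * m = lam := div_mul_cancel₀ _ hm0.ne'
    rw [e, ← hcm, hm]
    ring
  · exact mul_le_mul_of_nonneg_right hlam (by positivity)

/-- For every `α ∈ (0,1)`, the map `ℛ_α : 𝒱₁ → 𝒱₁` has a fixed point. -/
theorem RV_fixed_point (α : ℝ) (hα : α ∈ Ioo (0:ℝ) 1) :
    ∃ f : ℝ → ℝ, V1 α f ∧ ∀ x : ℝ, RV α f x = f x := by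
  obtain ⟨L, lam, q, h⟩ := exists_normalisedEigen hα.1 hα.2
  exact ⟨profile q, h.profile_mem hα.1 hα.2, h.RV_profile hα.1 hα.2⟩

end GSQGplane
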